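/- Let 0 < α < 1. There exists a constant c > 0 (depending only on α) such that: if f : ℂ → ℂ admits a Littlewood–Paley decomposition with homogeneous Besov B^α_{∞1}(ℝ²)-norm at most M, and N₁, N₂ are bounded normal operators on a complex Hilbert space H with N₁ − N₂ of trace class S₁, then f(N₁) − f(N₂) belongs to the Schatten class S_{1/α} and ‖f(N₁) − f(N₂)‖_{S_{1/α}} ≤ c · M · ‖N₁ − N₂‖_{S₁}^α. -/

import Mathlib

open MeasureTheory Filter
open scoped FourierTransform

/-- Fourier transform of `f` (as a tempered distribution, identifying `ℝ²` with `ℂ`)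
is supported in the closed disc of radius `σ` centered at the origin. -/
def FourierSupportedIn (f : ℂ → ℂ) (σ : ℝ) : Prop :=
  ∀ φ : SchwartzMap ℂ ℂ, Disjoint (tsupport ⇑φ) (Metric.closedBall (0 : ℂ) σ) →
    ∫ x : ℂ, f x * 𝓕 (⇑φ) x = 0

/-- `f : ℂ → ℂ` admits a Littlewood–Paley decomposition with homogeneous Besov
`B^α_{∞1}(ℝ²)`-norm at most `M`: there are bounded continuous functions `fₙ` (`n ∈ ℤ`)
with Fourier transforms supported in the disc of radius `2^{n+1}`, whose symmetric
partial sums converge to `f` uniformly on compact sets, and `Σₙ 2^{nα} ‖fₙ‖_∞ ≤ M`. -/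
def HasLPDecompBesov (f : ℂ → ℂ) (α : ℝ) (M : ℝ) : Prop :=
  ∃ F : ℤ → BoundedContinuousFunction ℂ ℂ,
    (∀ n : ℤ, FourierSupportedIn (⇑(F n)) ((2 : ℝ) ^ (n + 1))) ∧
    (∀ K : Set ℂ, IsCompact K →
      TendstoUniformlyOn (fun (N : ℕ) z => ∑ n ∈ Finset.Icc (-(N : ℤ)) (N : ℤ), F n z)
        f atTop K) ∧
    (Summable fun n : ℤ => (2 : ℝ) ^ ((n : ℝ) * α) * ‖F n‖) ∧
    ∑' n : ℤ, (2 : ℝ) ^ ((n : ℝ) * α) * ‖F n‖ ≤ M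

/-- The `j`-th singular value (approximation number) of a bounded operator `T`. -/
noncomputable def sNum {H : Type*} [NormedAddCommGroup H] [InnerProductSpace ℂ H]
    (T : H →L[ℂ] H) (j : ℕ) : ℝ :=
  sInf {c : ℝ | ∃ R : H →L[ℂ] H, LinearMap.rank (R : H →ₗ[ℂ] H) ≤ j ∧ c = ‖T - R‖}

/-- `T` belongs to the Schatten–von Neumann class `S_q`. -/
def MemSchatten {H : Type*} [NormedAddCommGroup H] [InnerProductSpace ℂ H]
    (q : ℝ) (T : H →L[ℂ] H) : Prop :=
  Summable fun j : ℕ => sNum T j ^ q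

/-- The Schatten `S_q` norm `(Σ_j s_j(T)^q)^{1/q}`. -/
noncomputable def schattenNorm {H : Type*} [NormedAddCommGroup H] [InnerProductSpace ℂ H]
    (q : ℝ) (T : H →L[ℂ] H) : ℝ :=
  (∑' j : ℕ, sNum T j ^ q) ^ (1 / q)

section ApproximationNumbers

variable {H : Type*} [NormedAddCommGroup H] [InnerProductSpace ℂ H]

lemma sNum_set_nonempty (T : H →L[ℂ] H) (j : ℕ) :
    {c : ℝ | ∃ R : H →L[ℂ] H, LinearMap.rank (R : H →ₗ[ℂ] H) ≤ j ∧ c = ‖T - R‖}.Nonempty :=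
  ⟨‖T - 0‖, 0, by simp, rfl⟩

lemma sNum_set_bddBelow (T : H →L[ℂ] H) (j : ℕ) :
    BddBelow {c : ℝ | ∃ R : H →L[ℂ] H,
      LinearMap.rank (R : H →ₗ[ℂ] H) ≤ j ∧ c = ‖T - R‖} :=
  ⟨0, by rintro _ ⟨R, -, rfl⟩; exact norm_nonneg _⟩

lemma sNum_nonneg (T : H →L[ℂ] H) (j : ℕ) : 0 ≤ sNum T j :=
  le_csInf (sNum_set_nonempty T j) (by rintro _ ⟨R, -, rfl⟩; exact norm_nonneg _)

lemma sNum_le_norm_sub {T R : H →L[ℂ] H} {j : ℕ}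
    (hR : LinearMap.rank (R : H →ₗ[ℂ] H) ≤ j) : sNum T j ≤ ‖T - R‖ :=
  csInf_le (sNum_set_bddBelow T j) ⟨R, hR, rfl⟩

lemma sNum_antitone (T : H →L[ℂ] H) : Antitone (sNum T) := by
  intro i j hij
  refine csInf_le_csInf (sNum_set_bddBelow T j) (sNum_set_nonempty T i) ?_
  rintro _ ⟨R, hR, rfl⟩
  exact ⟨R, hR.trans (by exact_mod_cast hij), rfl⟩

lemma exists_rank_le_norm_sub_lt (T : H →L[ℂ] H) (j : ℕ) {ε : ℝ} (hε : 0 < ε) :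
    ∃ R : H →L[ℂ] H, LinearMap.rank (R : H →ₗ[ℂ] H) ≤ j ∧ ‖T - R‖ < sNum T j + ε := by
  obtain ⟨_, ⟨R, hR, rfl⟩, h⟩ :=
    exists_lt_of_csInf_lt (sNum_set_nonempty T j) (lt_add_of_pos_right (sNum T j) hε)
  exact ⟨R, hR, h⟩

instance finiteDimensional_span_range_fin {n : ℕ} (e : Fin n → H) :
    FiniteDimensional ℂ (Submodule.span ℂ (Set.range e)) :=
  FiniteDimensional.span_of_finite ℂ (Set.finite_range e)

lemma rank_starProjection_span_le {n : ℕ} (e : Fin n → H) :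
    LinearMap.rank ((Submodule.span ℂ (Set.range e)).starProjection : H →ₗ[ℂ] H) ≤ n := by
  have h1 : LinearMap.range ((Submodule.span ℂ (Set.range e)).starProjection : H →ₗ[ℂ] H)
      = Submodule.span ℂ (Set.range e) := by
    exact Submodule.range_starProjection _
  unfold LinearMap.rank
  rw [h1, ← Module.finrank_eq_rank]
  have h2 := finrank_range_le_card (R := ℂ) e
  rw [Set.finrank, Fintype.card_fin] at h2
  exact_mod_cast h2

lemma orthonormal_snoc {n : ℕ} {e : Fin n → H} (he : Orthonormal ℂ e) {y : H} (hy : ‖y‖ = 1)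
    (hyo : y ∈ (Submodule.span ℂ (Set.range e))ᗮ) :
    Orthonormal ℂ (Fin.snoc (α := fun _ => H) e y) := by
  have hz : ∀ i, inner ℂ (e i) y = 0 := fun i =>
    (Submodule.mem_orthogonal _ _).1 hyo _ (Submodule.subset_span ⟨i, rfl⟩)
  refine ⟨fun i => ?_, fun i j hij => ?_⟩
  · refine Fin.lastCases ?_ (fun i => ?_) i
    · simpa using hy
    · simpa using he.1 i
  · revert hij
    refine Fin.lastCases ?_ (fun i => ?_) i <;> refine Fin.lastCases ?_ (fun j => ?_) j
    · simp
    · intro _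
      simp only [Fin.snoc_last, Fin.snoc_castSucc]
      exact inner_eq_zero_symm.1 (hz j)
    · intro _
      simpa using hz i
    · intro hij
      simp only [Fin.snoc_castSucc]
      exact he.2 (fun h => hij (by rw [h]))

lemma exists_orthonormal_inner_ge_aux {T : H →L[ℂ] H} {k : ℕ} {c : ℝ} (hc0 : 0 ≤ c)
    (hc : c < sNum T (2 * k)) (n : ℕ) (hn : n ≤ k + 1) :
    ∃ e f : Fin n → H, Orthonormal ℂ e ∧ Orthonormal ℂ f ∧
      ∀ i, c ≤ ‖inner ℂ (f i) (T (e i))‖ := by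
  induction n with
  | zero => exact ⟨Fin.elim0, Fin.elim0, ⟨fun i => i.elim0, fun i => i.elim0⟩,
      ⟨fun i => i.elim0, fun i => i.elim0⟩, fun i => i.elim0⟩
  | succ n ih =>
    obtain ⟨e, f, he, hf, hef⟩ := ih (by omega)
    set Q := Submodule.span ℂ (Set.range e)
    set P := Submodule.span ℂ (Set.range f)
    have : FiniteDimensional ℂ Q := finiteDimensional_span_range_fin e
    have : FiniteDimensional ℂ P := finiteDimensional_span_range_fin f
    set q := Q.starProjection
    set p := P.starProjection
    set R : H →L[ℂ] H := p ∘L (T - T ∘L q) + T ∘L q with hRdef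
    have hrank : LinearMap.rank (R : H →ₗ[ℂ] H) ≤ ((2 * k : ℕ) : Cardinal) := by
      have h1 : LinearMap.rank ((p : H →ₗ[ℂ] H) ∘ₗ ((T - T ∘L q : H →L[ℂ] H) : H →ₗ[ℂ] H))
          ≤ n := (LinearMap.rank_comp_le_left _ _).trans (rank_starProjection_span_le f)
      have h2 : LinearMap.rank ((T : H →ₗ[ℂ] H) ∘ₗ (q : H →ₗ[ℂ] H)) ≤ n :=
        (LinearMap.rank_comp_le_right _ _).trans (rank_starProjection_span_le e)
      have h3 := (LinearMap.rank_add_le _ _).trans (add_le_add h1 h2)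
      refine le_trans (le_of_eq_of_le ?_ h3) ?_
      · rfl
      · norm_cast; omega
    have hlt : c < ‖T - R‖ := hc.trans_le (sNum_le_norm_sub hrank)
    obtain ⟨x, hx⟩ : ∃ x, c * ‖x‖ < ‖(T - R) x‖ := by
      by_contra! h
      exact absurd (ContinuousLinearMap.opNorm_le_bound _ hc0 h) (not_le.2 hlt)
    set y := x - q x with hy
    set g := T y - p (T y) with hg
    have hgx : (T - R) x = g := by
      simp [hRdef, hg, hy, map_sub]; abel
    have hyx : ‖y‖ ≤ ‖x‖ := by
      have : y = Qᗮ.starProjection x := by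
        rw [Submodule.starProjection_orthogonal']; rfl
      rw [this]
      exact Submodule.norm_starProjection_apply_le _ _
    rw [hgx] at hx
    have hg0 : 0 < ‖g‖ := lt_of_le_of_lt (by positivity) hx
    have hy0 : 0 < ‖y‖ := by
      rw [norm_pos_iff]
      intro h0
      rw [hg, h0] at hg0
      simp at hg0
    have hyQ : y ∈ Qᗮ := Q.sub_starProjection_mem_orthogonal x
    have hgP : g ∈ Pᗮ := P.sub_starProjection_mem_orthogonal (T y)
    have hgg : inner ℂ g (T y) = (‖g‖ : ℂ) ^ 2 := by
      have h1 : T y = g + p (T y) := by rw [hg]; abel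
      have h2 : inner ℂ g (p (T y)) = 0 :=
        (Submodule.mem_orthogonal' _ _).1 hgP _ (P.starProjection_apply_mem _)
      rw [h1, inner_add_right, h2, add_zero, inner_self_eq_norm_sq_to_K]
      rfl
    refine ⟨Fin.snoc e (((‖y‖ : ℂ)⁻¹) • y), Fin.snoc f (((‖g‖ : ℂ)⁻¹) • g),
      orthonormal_snoc he ?_ (Submodule.smul_mem _ _ hyQ),
      orthonormal_snoc hf ?_ (Submodule.smul_mem _ _ hgP), fun i => ?_⟩
    · rw [norm_smul, norm_inv, Complex.norm_real, norm_norm, inv_mul_cancel₀ hy0.ne']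
    · rw [norm_smul, norm_inv, Complex.norm_real, norm_norm, inv_mul_cancel₀ hg0.ne']
    · refine Fin.lastCases ?_ (fun i => ?_) i
      · simp only [Fin.snoc_last, map_smul, inner_smul_left, inner_smul_right, hgg, norm_mul,
          norm_inv, norm_pow, RCLike.norm_conj, Complex.norm_real, norm_norm]
        have : ‖g‖⁻¹ * (‖y‖⁻¹ * ‖g‖ ^ 2) = ‖g‖ / ‖y‖ := by field_simp
        have h5 : c ≤ ‖g‖ / ‖y‖ := by
          rw [le_div_iff₀ hy0]
          exact (mul_le_mul_of_nonneg_left hyx hc0).trans hx.le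
        calc c ≤ ‖g‖ / ‖y‖ := h5
          _ ≤ _ := by rw [← this]; apply le_of_eq; ring
      · simpa using hef i

lemma exists_orthonormal_inner_ge {T : H →L[ℂ] H} {k : ℕ} {c : ℝ} (hc0 : 0 ≤ c)
    (hc : c < sNum T (2 * k)) :
    ∃ e f : Fin (k + 1) → H, Orthonormal ℂ e ∧ Orthonormal ℂ f ∧
      ∀ i, c ≤ ‖inner ℂ (f i) (T (e i))‖ :=
  exists_orthonormal_inner_ge_aux hc0 hc (k + 1) le_rfl

end ApproximationNumbers

/-- `∑ i, ‖⟪e i, x⟫‖² ≤ C² ‖x‖²` for all `x`. -/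
def BesselBound {H : Type*} [NormedAddCommGroup H] [InnerProductSpace ℂ H] {ι : Type}
    [Fintype ι] (e : ι → H) (C : ℝ) : Prop :=
  ∀ x, ∑ i, ‖inner ℂ (e i) x‖ ^ 2 ≤ C ^ 2 * ‖x‖ ^ 2

/-- The trace norm of `A` is at most `c`, expressed by duality against finite Bessel families. -/
def TraceBound {H : Type*} [NormedAddCommGroup H] [InnerProductSpace ℂ H]
    (A : H →L[ℂ] H) (c : ℝ) : Prop :=
  ∀ (ι : Type) [Fintype ι] (e f : ι → H) (C₁ C₂ : ℝ), 0 ≤ C₁ → 0 ≤ C₂ →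
    BesselBound e C₁ → BesselBound f C₂ → ∑ i, ‖inner ℂ (f i) (A (e i))‖ ≤ C₁ * C₂ * c

section TraceBound

variable {H : Type*} [NormedAddCommGroup H] [InnerProductSpace ℂ H]

lemma Orthonormal.besselBound {ι : Type} [Fintype ι] {e : ι → H} (he : Orthonormal ℂ e) :
    BesselBound e 1 := fun x => by
  simpa using he.sum_inner_products_le x (s := Finset.univ)

lemma TraceBound.sum_inner_le {A : H →L[ℂ] H} {c : ℝ} (hA : TraceBound A c) {ι : Type}
    [Fintype ι] {e f : ι → H} (he : Orthonormal ℂ e) (hf : Orthonormal ℂ f) :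
    ∑ i, ‖inner ℂ (f i) (A (e i))‖ ≤ c := by
  simpa using hA ι e f 1 1 zero_le_one zero_le_one he.besselBound hf.besselBound

lemma TraceBound.mono {A : H →L[ℂ] H} {c d : ℝ} (hA : TraceBound A c) (h : c ≤ d) :
    TraceBound A d := fun ι _ e f C₁ C₂ h1 h2 he hf =>
  (hA ι e f C₁ C₂ h1 h2 he hf).trans (mul_le_mul_of_nonneg_left h (mul_nonneg h1 h2))

lemma TraceBound.add {A B : H →L[ℂ] H} {c d : ℝ} (hA : TraceBound A c) (hB : TraceBound B d) :
    TraceBound (A + B) (c + d) := fun ι _ e f C₁ C₂ h1 h2 he hf => by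
  rw [mul_add]
  refine le_trans ?_ (add_le_add (hA ι e f C₁ C₂ h1 h2 he hf) (hB ι e f C₁ C₂ h1 h2 he hf))
  rw [← Finset.sum_add_distrib]
  refine Finset.sum_le_sum fun i _ => ?_
  rw [add_apply, inner_add_right]
  exact norm_add_le _ _

lemma TraceBound.smul {A : H →L[ℂ] H} {c : ℝ} (hA : TraceBound A c) (a : ℂ) :
    TraceBound (a • A) (‖a‖ * c) := fun ι _ e f C₁ C₂ h1 h2 he hf => by
  simp only [smul_apply, inner_smul_right, norm_mul, ← Finset.mul_sum]
  calc _ ≤ ‖a‖ * (C₁ * C₂ * c) :=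
        mul_le_mul_of_nonneg_left (hA ι e f C₁ C₂ h1 h2 he hf) (norm_nonneg _)
    _ = _ := by ring

lemma TraceBound.adjoint [CompleteSpace H] {A : H →L[ℂ] H} {c : ℝ} (hA : TraceBound A c) :
    TraceBound (star A) c := fun ι _ e f C₁ C₂ h1 h2 he hf => by
  have h := hA ι f e C₂ C₁ h2 h1 hf he
  rw [mul_comm C₂] at h
  refine le_trans (le_of_eq (Finset.sum_congr rfl fun i _ => ?_)) h
  rw [ContinuousLinearMap.star_eq_adjoint, ContinuousLinearMap.adjoint_inner_right,
    norm_inner_symm]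

lemma TraceBound.of_tendsto {A : ℕ → H →L[ℂ] H} {B : H →L[ℂ] H} {c : ℝ}
    (hA : ∀ n, TraceBound (A n) c) (h : Tendsto A atTop (nhds B)) : TraceBound B c :=
  fun ι _ e f C₁ C₂ h1 h2 he hf => by
  refine le_of_tendsto' (x := atTop) (f := fun n => ∑ i, ‖inner ℂ (f i) (A n (e i))‖) ?_
    fun n => hA n ι e f C₁ C₂ h1 h2 he hf
  refine tendsto_finsetSum _ fun i _ => ((tendsto_const_nhds.inner ?_).norm)
  exact ((ContinuousLinearMap.apply ℂ H (e i)).continuous.tendsto B).comp h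

lemma BesselBound.norm_sum_le {ι : Type} [Fintype ι] {e f : ι → H} {C₁ C₂ : ℝ} (h1 : 0 ≤ C₁)
    (h2 : 0 ≤ C₂) (he : BesselBound e C₁) (hf : BesselBound f C₂) (x y : H) :
    ∑ i, ‖inner ℂ (e i) x‖ * ‖inner ℂ (f i) y‖ ≤ (C₁ * ‖x‖) * (C₂ * ‖y‖) := by
  refine (Real.sum_mul_le_sqrt_mul_sqrt _ _ _).trans ?_
  refine mul_le_mul ?_ ?_ (Real.sqrt_nonneg _) (by positivity)
  · exact Real.sqrt_le_iff.2 ⟨by positivity, by rw [mul_pow]; exact he x⟩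
  · exact Real.sqrt_le_iff.2 ⟨by positivity, by rw [mul_pow]; exact hf y⟩

lemma TraceBound.of_rank_le [CompleteSpace H] {A : H →L[ℂ] H} {r : ℕ}
    (hr : LinearMap.rank (A : H →ₗ[ℂ] H) ≤ r) : TraceBound A (r * ‖A‖) := by
  set V := LinearMap.range (A : H →ₗ[ℂ] H) with hV
  have hVr : Module.rank ℂ V ≤ r := hr
  have hfin : FiniteDimensional ℂ V :=
    Module.rank_lt_aleph0_iff.1 (hVr.trans_lt (Cardinal.natCast_lt_aleph0))
  have hfr : Module.finrank ℂ V ≤ r := by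
    rw [← Module.finrank_eq_rank] at hVr
    exact_mod_cast hVr
  set b := stdOrthonormalBasis ℂ V
  intro ι _ e f C₁ C₂ h1 h2 he hf
  have key : ∀ i, ‖inner ℂ (f i) (A (e i))‖ ≤
      ∑ k, ‖inner ℂ (e i) ((ContinuousLinearMap.adjoint A) (b k : H))‖ *
        ‖inner ℂ (f i) (b k : H)‖ := fun i => by
    have h3 : A (e i) = ∑ k, inner ℂ (b k : H) (A (e i)) • (b k : H) := by
      have := congrArg (Subtype.val) (b.sum_repr' (⟨A (e i), ⟨e i, rfl⟩⟩ : V))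
      simpa using this.symm
    rw [h3, inner_sum]
    refine (norm_sum_le _ _).trans (Finset.sum_le_sum fun k _ => ?_)
    rw [inner_smul_right, norm_mul, ContinuousLinearMap.adjoint_inner_right, norm_inner_symm]
  calc ∑ i, ‖inner ℂ (f i) (A (e i))‖
      ≤ ∑ i, ∑ k, ‖inner ℂ (e i) ((ContinuousLinearMap.adjoint A) (b k : H))‖ *
        ‖inner ℂ (f i) (b k : H)‖ := Finset.sum_le_sum fun i _ => key i
    _ = ∑ k, ∑ i, ‖inner ℂ (e i) ((ContinuousLinearMap.adjoint A) (b k : H))‖ *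
        ‖inner ℂ (f i) (b k : H)‖ := Finset.sum_comm
    _ ≤ ∑ k : Fin (Module.finrank ℂ V), C₁ * C₂ * ‖A‖ := Finset.sum_le_sum fun k _ => by
        refine (he.norm_sum_le h1 h2 hf _ _).trans ?_
        have hb : ‖(b k : H)‖ = 1 := b.orthonormal.1 k
        have h4 : ‖(ContinuousLinearMap.adjoint A) (b k : H)‖ ≤ ‖A‖ := by
          have := (ContinuousLinearMap.adjoint A).le_opNorm (b k : H)
          rwa [hb, mul_one, LinearIsometryEquiv.norm_map] at this
        rw [hb, mul_one]
        calc C₁ * ‖(ContinuousLinearMap.adjoint A) (b k : H)‖ * C₂ ≤ C₁ * ‖A‖ * C₂ := by gcongr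
          _ = _ := by ring
    _ = (Module.finrank ℂ V : ℝ) * (C₁ * C₂ * ‖A‖) := by simp
    _ ≤ r * (C₁ * C₂ * ‖A‖) := by
        gcongr
    _ = _ := by ring

lemma sum_two_pow_mul_le_tsum {s : ℕ → ℝ} (hs : Antitone s) (h0 : ∀ n, 0 ≤ s n)
    (hsum : Summable s) (n : ℕ) :
    ∑ k ∈ Finset.range n, (2 : ℝ) ^ k * s (2 ^ k) ≤ 2 * ∑' j, s j := by
  have h := Finset.sum_condensed_le (f := s) (fun _ _ _ h => hs h) n
  have h1 : ∑ k ∈ Finset.range n, (2 : ℝ) ^ k * s (2 ^ k) ≤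
      ∑ k ∈ Finset.range (n + 1), 2 ^ k • s (2 ^ k) := by
    rw [Finset.sum_range_succ]
    have : 0 ≤ 2 ^ n • s (2 ^ n) := nsmul_nonneg (h0 _) _
    simpa using this
  have h2 : s 1 + ∑ k ∈ Finset.Ico 2 (2 ^ n + 1), s k ≤ ∑' j, s j := by
    have := hsum.sum_le_tsum (insert 1 (Finset.Ico 2 (2 ^ n + 1))) (fun i _ => h0 i)
    rwa [Finset.sum_insert (by simp)] at this
  have h3 : 0 ≤ s 1 := h0 1
  rw [nsmul_eq_mul] at h
  push_cast at h
  linarith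

lemma TraceBound.sum {ι : Type*} (s : Finset ι) {A : ι → H →L[ℂ] H} {c : ι → ℝ}
    (h : ∀ i ∈ s, TraceBound (A i) (c i)) : TraceBound (∑ i ∈ s, A i) (∑ i ∈ s, c i) := by
  classical
  induction s using Finset.induction_on with
  | empty => intro ι _ e f C₁ C₂ h1 h2 he hf; simp
  | insert a s ha ih =>
    rw [Finset.sum_insert ha, Finset.sum_insert ha]
    exact (h a (Finset.mem_insert_self _ _)).add
      (ih fun i hi => h i (Finset.mem_insert_of_mem hi))

lemma MemSchatten.traceBound [CompleteSpace H] {T : H →L[ℂ] H} (hT : MemSchatten 1 T) :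
    TraceBound T (14 * ∑' j, sNum T j) := by
  have hsum : Summable (sNum T) := by simpa [MemSchatten] using hT
  set S := ∑' j, sNum T j with hS
  have hpos : ∀ ε : ℝ, 0 < ε → TraceBound T (14 * S + 13 * ε) := by
    intro ε hε
    choose R hR hRT using fun k : ℕ =>
      exists_rank_le_norm_sub_lt T (2 ^ k) (ε := ε * (1 / 4) ^ k) (by positivity)
    have hlim : Tendsto R atTop (nhds T) := by
      rw [tendsto_iff_norm_sub_tendsto_zero]
      have h1 : Tendsto (fun k : ℕ => sNum T (2 ^ k) + ε * (1 / 4) ^ k) atTop (nhds 0) := by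
        have h2 : Tendsto (fun k : ℕ => sNum T (2 ^ k)) atTop (nhds 0) :=
          hsum.tendsto_atTop_zero.comp (tendsto_pow_atTop_atTop_of_one_lt one_lt_two)
        have h3 : Tendsto (fun k : ℕ => ε * (1 / 4 : ℝ) ^ k) atTop (nhds (ε * 0)) :=
          (tendsto_pow_atTop_nhds_zero_of_lt_one (by norm_num) (by norm_num)).const_mul ε
        simpa using h2.add h3
      refine squeeze_zero (fun _ => norm_nonneg _) (fun k => ?_) h1
      rw [norm_sub_rev]
      exact (hRT k).le
    have hdiff : ∀ k, TraceBound (R (k + 1) - R k)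
        (6 * ((2 : ℝ) ^ k * sNum T (2 ^ k)) + 6 * ε * (1 / 2) ^ k) := by
      intro k
      have hrk : LinearMap.rank ((R (k + 1) - R k : H →L[ℂ] H) : H →ₗ[ℂ] H)
          ≤ ((3 * 2 ^ k : ℕ) : Cardinal) := by
        have h1 : ((R (k + 1) - R k : H →L[ℂ] H) : H →ₗ[ℂ] H) =
            (R (k + 1) : H →ₗ[ℂ] H) + (R k : H →ₗ[ℂ] H) ∘ₗ (-LinearMap.id) := by
          ext x; simp [sub_eq_add_neg]
        rw [h1]
        refine (LinearMap.rank_add_le _ _).trans ((add_le_add (hR (k + 1))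
          ((LinearMap.rank_comp_le_left _ _).trans (hR k))).trans ?_)
        norm_cast
        rw [pow_succ]; omega
      refine (TraceBound.of_rank_le hrk).mono ?_
      have h2 : ‖R (k + 1) - R k‖ ≤ 2 * sNum T (2 ^ k) + 2 * (ε * (1 / 4) ^ k) := by
        have h3 : R (k + 1) - R k = (T - R k) - (T - R (k + 1)) := by abel
        rw [h3]
        refine (norm_sub_le _ _).trans ?_
        have h4 := (hRT k).le
        have h5 := (hRT (k + 1)).le
        have h6 : sNum T (2 ^ (k + 1)) ≤ sNum T (2 ^ k) :=
          sNum_antitone T (Nat.pow_le_pow_right (by norm_num) (Nat.le_succ k))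
        have h7 : ε * (1 / 4 : ℝ) ^ (k + 1) ≤ ε * (1 / 4) ^ k := by
          refine mul_le_mul_of_nonneg_left ?_ hε.le
          exact pow_le_pow_of_le_one (by norm_num) (by norm_num) (Nat.le_succ k)
        linarith
      have h8 : (2 : ℝ) ^ k * (1 / 4) ^ k = (1 / 2) ^ k := by
        rw [← mul_pow]; norm_num
      push_cast
      calc (3 * 2 ^ k : ℝ) * ‖R (k + 1) - R k‖
          ≤ 3 * 2 ^ k * (2 * sNum T (2 ^ k) + 2 * (ε * (1 / 4) ^ k)) := by gcongr
        _ = 6 * ((2 : ℝ) ^ k * sNum T (2 ^ k)) + 6 * ε * (2 ^ k * (1 / 4) ^ k) := by ring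
        _ = _ := by rw [h8]
    have hR0 : TraceBound (R 0) (2 * S + ε) := by
      refine (TraceBound.of_rank_le (hR 0)).mono ?_
      have h1 : ‖R 0‖ ≤ ‖T‖ + ‖T - R 0‖ := by
        calc ‖R 0‖ = ‖T - (T - R 0)‖ := by congr 1; abel
          _ ≤ _ := norm_sub_le _ _
      have h2 : ‖T‖ = sNum T 0 := by
        refine le_antisymm (le_csInf (sNum_set_nonempty T 0) ?_) ?_
        · rintro _ ⟨R', hR', rfl⟩
          have h3 : (R' : H →ₗ[ℂ] H) = 0 := by
            rw [Nat.cast_zero, nonpos_iff_eq_zero] at hR'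
            rw [LinearMap.rank, Submodule.rank_eq_zero, LinearMap.range_eq_bot] at hR'
            exact hR'
          have h4 : R' = 0 := by
            ext x; exact congrArg (fun g : H →ₗ[ℂ] H => g x) h3
          simp [h4]
        · simpa using sNum_le_norm_sub (T := T) (R := 0) (j := 0) (by simp)
      have h3 := (hRT 0).le
      have h4 : sNum T 0 + sNum T 1 ≤ S := by
        have := hsum.sum_le_tsum (Finset.range 2) (fun i _ => sNum_nonneg T i)
        simpa [Finset.sum_range_succ] using this
      simp only [pow_zero, mul_one, Nat.cast_one, one_mul] at *
      have h5 := sNum_nonneg T 0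
      have h6 := sNum_nonneg T 1
      linarith
    refine TraceBound.of_tendsto (A := R) (fun n => ?_) hlim
    have htel : R n = R 0 + ∑ k ∈ Finset.range n, (R (k + 1) - R k) := by
      rw [Finset.sum_range_sub]; abel
    rw [htel]
    refine (hR0.add (TraceBound.sum _ fun k _ => hdiff k)).mono ?_
    rw [Finset.sum_add_distrib, ← Finset.mul_sum, ← Finset.mul_sum]
    have h1 := sum_two_pow_mul_le_tsum (sNum_antitone T) (sNum_nonneg T) hsum n
    have h2 : ∑ k ∈ Finset.range n, (1 / 2 : ℝ) ^ k ≤ 2 := by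
      have := summable_geometric_two.sum_le_tsum (Finset.range n) (fun i _ => by positivity)
      rwa [tsum_geometric_two] at this
    nlinarith
  intro ι _ e f C₁ C₂ h1 h2 he hf
  have hlim : Tendsto (fun ε : ℝ => C₁ * C₂ * (14 * S + 13 * ε)) (nhdsWithin 0 (Set.Ioi 0))
      (nhds (C₁ * C₂ * (14 * S + 13 * 0))) := by
    refine tendsto_nhdsWithin_of_tendsto_nhds (Continuous.tendsto ?_ 0)
    fun_prop
  rw [mul_zero, add_zero] at hlim
  refine ge_of_tendsto hlim ?_
  filter_upwards [self_mem_nhdsWithin] with ε hε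
  exact hpos ε hε ι e f C₁ C₂ h1 h2 he hf

end TraceBound

section FunctionalCalculus

variable {H : Type*} [NormedAddCommGroup H] [InnerProductSpace ℂ H] [CompleteSpace H]
  {E : Type*} [NormedAddCommGroup E] [InnerProductSpace ℂ E]

lemma sum_norm_sq_cfc_apply_le {N : H →L[ℂ] H} {κ : Type*} [Fintype κ]
    {q : κ → ℂ → ℂ} (hq : ∀ k, Continuous (q k)) {C : ℝ} (hC : 0 ≤ C)
    (hb : ∀ z ∈ spectrum ℂ N, ∑ k, ‖q k z‖ ^ 2 ≤ C ^ 2) (u : H) :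
    ∑ k, ‖cfc (q k) N u‖ ^ 2 ≤ C ^ 2 * ‖u‖ ^ 2 := by
  set r : ℂ → ℂ := fun z => ((Real.sqrt (∑ k, ‖q k z‖ ^ 2) : ℝ) : ℂ) with hr
  have hrc : Continuous r := by
    refine Complex.continuous_ofReal.comp (Real.continuous_sqrt.comp ?_)
    exact continuous_finsetSum _ fun k _ => ((hq k).norm.pow 2)
  have hmul : star (cfc r N) * cfc r N = ∑ k, star (cfc (q k) N) * cfc (q k) N := by
    have h1 : ∀ k, star (cfc (q k) N) * cfc (q k) N = cfc (fun z => star (q k z) * q k z) N := by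
      intro k
      rw [← cfc_star, ← cfc_mul _ _ N ((hq k).star.continuousOn) ((hq k).continuousOn)]
    simp_rw [h1]
    rw [← cfc_star, ← cfc_mul _ _ N (hrc.star.continuousOn) (hrc.continuousOn),
      ← cfc_sum (fun k => fun z => star (q k z) * q k z) N Finset.univ
        (fun k _ => ((hq k).star.mul (hq k)).continuousOn)]
    congr 1
    ext z
    have h2 : ∀ w : ℂ, star w * w = ((‖w‖ ^ 2 : ℝ) : ℂ) := fun w => by
      rw [Complex.star_def, mul_comm, Complex.mul_conj, Complex.normSq_eq_norm_sq]
    simp only [Finset.sum_apply, h2, hr, Complex.norm_real]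
    rw [Real.norm_eq_abs, sq_abs, Real.sq_sqrt (Finset.sum_nonneg fun _ _ => by positivity)]
    push_cast
    rfl
  have hinner : ∀ A : H →L[ℂ] H, ‖A u‖ ^ 2 = RCLike.re (inner ℂ u ((star A * A) u)) := by
    intro A
    rw [mul_apply_eq_comp, ContinuousLinearMap.star_eq_adjoint,
      ContinuousLinearMap.adjoint_inner_right, inner_self_eq_norm_sq]
  have hsum : ∑ k, ‖cfc (q k) N u‖ ^ 2 = ‖cfc r N u‖ ^ 2 := by
    rw [hinner (cfc r N), hmul, sum_apply, inner_sum, map_sum]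
    exact Finset.sum_congr rfl fun k _ => hinner _
  have hn : ‖cfc r N‖ ≤ C := norm_cfc_le hC fun z hz => by
    rw [hr, Complex.norm_real, Real.norm_of_nonneg (Real.sqrt_nonneg _)]
    exact Real.sqrt_le_iff.2 ⟨hC, hb z hz⟩
  rw [hsum, ← mul_pow]
  exact pow_le_pow_left₀ (norm_nonneg _)
    (((cfc r N).le_opNorm u).trans (mul_le_mul_of_nonneg_right hn (norm_nonneg _))) 2

/-- The double operator integral of the kernel `⟪x z, y w⟫`, for `y` valued in the span of `b`. -/
noncomputable def kernelTransform {d : ℕ} (b : Fin d → E) (N₁ N₂ : H →L[ℂ] H) (x y : ℂ → E)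
    (B : H →L[ℂ] H) : H →L[ℂ] H :=
  ∑ k, cfc (fun z => inner ℂ (x z) (b k)) N₁ * B * cfc (fun z => inner ℂ (b k) (y z)) N₂

variable {N₁ N₂ : H →L[ℂ] H} {d : ℕ} {b : Fin d → E} {x y : ℂ → E}

lemma sum_norm_sq_cfc_inner_left_le (hb : Orthonormal ℂ b)
    (hx : Continuous x) {C : ℝ} (hC : 0 ≤ C) (hxC : ∀ z ∈ spectrum ℂ N₁, ‖x z‖ ≤ C) (u : H) :
    ∑ k, ‖cfc (fun z => inner ℂ (x z) (b k)) N₁ u‖ ^ 2 ≤ C ^ 2 * ‖u‖ ^ 2 := by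
  refine sum_norm_sq_cfc_apply_le (q := fun k z => inner ℂ (x z) (b k))
    (fun k => hx.inner continuous_const) hC (fun z hz => ?_) u
  simp_rw [norm_inner_symm (x z)]
  exact (hb.sum_inner_products_le (x z)).trans (pow_le_pow_left₀ (norm_nonneg _) (hxC z hz) 2)

lemma sum_norm_sq_cfc_inner_right_le (hb : Orthonormal ℂ b)
    (hx : Continuous x) {C : ℝ} (hC : 0 ≤ C) (hxC : ∀ z ∈ spectrum ℂ N₁, ‖x z‖ ≤ C) (u : H) :
    ∑ k, ‖cfc (fun z => inner ℂ (b k) (x z)) N₁ u‖ ^ 2 ≤ C ^ 2 * ‖u‖ ^ 2 := by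
  refine sum_norm_sq_cfc_apply_le (q := fun k z => inner ℂ (b k) (x z))
    (fun k => continuous_const.inner hx) hC (fun z hz => ?_) u
  exact (hb.sum_inner_products_le (x z)).trans (pow_le_pow_left₀ (norm_nonneg _) (hxC z hz) 2)

lemma star_cfc_inner (N : H →L[ℂ] H) (x y : ℂ → E) :
    star (cfc (fun z => inner ℂ (x z) (y z)) N) = cfc (fun z => inner ℂ (y z) (x z)) N := by
  rw [← cfc_star]
  congr 1
  ext z
  exact inner_conj_symm _ _

lemma TraceBound.kernelTransform (hb : Orthonormal ℂ b) (hx : Continuous x)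
    (hy : Continuous y) {C C' : ℝ} (hC : 0 ≤ C)
    (hC' : 0 ≤ C') (hxC : ∀ z ∈ spectrum ℂ N₁, ‖x z‖ ≤ C)
    (hyC : ∀ z ∈ spectrum ℂ N₂, ‖y z‖ ≤ C') {B : H →L[ℂ] H} {c : ℝ} (hB : TraceBound B c) :
    TraceBound (kernelTransform b N₁ N₂ x y B) (C * C' * c) := by
  intro ι _ e f C₁ C₂ h1 h2 he hf
  have hstar : ∀ (A : H →L[ℂ] H) (v w : H), inner ℂ (star A v) w = inner ℂ v (A w) := by
    intro A v w
    rw [ContinuousLinearMap.star_eq_adjoint, ContinuousLinearMap.adjoint_inner_left]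
  have he' : BesselBound (fun i : ι × Fin d =>
      cfc (fun z => inner ℂ (b i.2) (y z)) N₂ (e i.1)) (C₁ * C') := fun v => by
    rw [Fintype.sum_prod_type, Finset.sum_comm]
    calc _ ≤ ∑ k, C₁ ^ 2 * ‖cfc (fun z => inner ℂ (y z) (b k)) N₂ v‖ ^ 2 := by
          refine Finset.sum_le_sum fun k _ => ?_
          refine le_trans (le_of_eq (Finset.sum_congr rfl fun i _ => ?_)) (he _)
          dsimp only
          rw [← hstar, star_cfc_inner]
      _ ≤ C₁ ^ 2 * (C' ^ 2 * ‖v‖ ^ 2) := by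
          rw [← Finset.mul_sum]
          exact mul_le_mul_of_nonneg_left
            (sum_norm_sq_cfc_inner_left_le hb hy hC' hyC v) (by positivity)
      _ = _ := by ring
  have hf' : BesselBound (fun i : ι × Fin d =>
      cfc (fun z => inner ℂ (b i.2) (x z)) N₁ (f i.1)) (C₂ * C) := fun v => by
    rw [Fintype.sum_prod_type, Finset.sum_comm]
    calc _ ≤ ∑ k, C₂ ^ 2 * ‖cfc (fun z => inner ℂ (x z) (b k)) N₁ v‖ ^ 2 := by
          refine Finset.sum_le_sum fun k _ => ?_
          refine le_trans (le_of_eq (Finset.sum_congr rfl fun i _ => ?_)) (hf _)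
          dsimp only
          rw [← hstar, star_cfc_inner]
      _ ≤ C₂ ^ 2 * (C ^ 2 * ‖v‖ ^ 2) := by
          rw [← Finset.mul_sum]
          exact mul_le_mul_of_nonneg_left
            (sum_norm_sq_cfc_inner_left_le hb hx hC hxC v) (by positivity)
      _ = _ := by ring
  have h := hB (ι × Fin d) _ _ _ _ (mul_nonneg h1 hC') (mul_nonneg h2 hC) he' hf'
  rw [Fintype.sum_prod_type] at h
  refine le_trans (Finset.sum_le_sum fun i _ => ?_) (h.trans (le_of_eq (by ring)))
  rw [_root_.kernelTransform, sum_apply, inner_sum]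
  refine (norm_sum_le _ _).trans (le_of_eq (Finset.sum_congr rfl fun k _ => ?_))
  rw [mul_assoc, mul_apply_eq_comp, mul_apply_eq_comp, ← hstar, star_cfc_inner]

lemma norm_kernelTransform_one_le (hb : Orthonormal ℂ b) (hx : Continuous x)
    (hy : Continuous y) {C C' : ℝ} (hC : 0 ≤ C)
    (hC' : 0 ≤ C') (hxC : ∀ z ∈ spectrum ℂ N₁, ‖x z‖ ≤ C)
    (hyC : ∀ z ∈ spectrum ℂ N₂, ‖y z‖ ≤ C') :
    ‖kernelTransform b N₁ N₂ x y 1‖ ≤ C * C' := by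
  refine ContinuousLinearMap.opNorm_le_bound _ (mul_nonneg hC hC') fun u => ?_
  set S := kernelTransform b N₁ N₂ x y 1 with hS
  have h1 : ‖S u‖ * ‖S u‖ ≤ (C * C' * ‖u‖) * ‖S u‖ := by
    rw [← inner_self_eq_norm_mul_norm (𝕜 := ℂ) (S u)]
    refine (RCLike.re_le_norm _).trans ?_
    have h2 : ∀ v, inner ℂ v (S u) = ∑ k, inner ℂ (cfc (fun z => inner ℂ (b k) (x z)) N₁ v)
        (cfc (fun z => inner ℂ (b k) (y z)) N₂ u) := by
      intro v
      rw [hS, kernelTransform, sum_apply, inner_sum]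
      refine Finset.sum_congr rfl fun k _ => ?_
      rw [mul_one, mul_apply_eq_comp, ← star_cfc_inner,
        ContinuousLinearMap.star_eq_adjoint, ContinuousLinearMap.adjoint_inner_right]
    rw [h2]
    refine (norm_sum_le _ _).trans ((Finset.sum_le_sum fun k _ => norm_inner_le_norm _ _).trans ?_)
    refine (Real.sum_mul_le_sqrt_mul_sqrt _ _ _).trans ?_
    have h3 : √(∑ k, ‖cfc (fun z => inner ℂ (b k) (x z)) N₁ (S u)‖ ^ 2) ≤ C * ‖S u‖ :=
      Real.sqrt_le_iff.2 ⟨by positivity, by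
        rw [mul_pow]; exact sum_norm_sq_cfc_inner_right_le hb hx hC hxC _⟩
    have h4 : √(∑ k, ‖cfc (fun z => inner ℂ (b k) (y z)) N₂ u‖ ^ 2) ≤ C' * ‖u‖ :=
      Real.sqrt_le_iff.2 ⟨by positivity, by
        rw [mul_pow]; exact sum_norm_sq_cfc_inner_right_le hb hy hC' hyC _⟩
    calc _ ≤ (C * ‖S u‖) * (C' * ‖u‖) :=
          mul_le_mul h3 h4 (Real.sqrt_nonneg _) (by positivity)
      _ = _ := by ring
  rcases (norm_nonneg (S u)).eq_or_lt with h0 | h0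
  · rw [← h0]; positivity
  · exact le_of_mul_le_mul_right h1 h0

end FunctionalCalculus

lemma IsCompact.exists_finite_partition {K : Set ℂ} (hK : IsCompact K) {δ : ℝ} (hδ : 0 < δ) :
    ∃ (ι : Type) (_ : Fintype ι) (p : ι → ℂ) (η : ι → ℂ → ℝ), (∀ i, p i ∈ K) ∧
      (∀ i, Continuous (η i)) ∧ (∀ i z, 0 ≤ η i z) ∧ (∀ z ∈ K, ∑ i, η i z = 1) ∧
      ∀ i z, η i z ≠ 0 → dist z (p i) < δ := by
  obtain ⟨t, htK, htf, hcov⟩ := hK.finite_cover_balls hδ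
  have hfin : Fintype t := htf.fintype
  obtain ⟨η, hη⟩ := PartitionOfUnity.exists_isSubordinate hK.isClosed
    (fun i : t => Metric.ball (i : ℂ) δ) (fun _ => Metric.isOpen_ball)
    (by rwa [← Set.biUnion_eq_iUnion t (fun x _ => Metric.ball x δ)])
  refine ⟨t, hfin, Subtype.val, fun i => η i, fun i => htK i.2, fun i => (η i).continuous,
    fun i z => η.nonneg i z, fun z hz => ?_, fun i z h => hη i (subset_tsupport _ h)⟩
  rw [← finsum_eq_sum_of_fintype]
  exact η.sum_eq_one hz

section WeightedAverage

variable {ι : Type} [Fintype ι] {E : Type*} [NormedAddCommGroup E] [InnerProductSpace ℂ E]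

/-- The function `z ↦ ∑ i, η i z • v i`. -/
noncomputable def weightedAverage (η : ι → ℂ → ℝ) (v : ι → E) (z : ℂ) : E :=
  ∑ i, (η i z : ℂ) • v i

variable {η : ι → ℂ → ℝ}

lemma continuous_weightedAverage (hη : ∀ i, Continuous (η i)) (v : ι → E) :
    Continuous (weightedAverage η v) :=
  continuous_finsetSum _ fun i _ => (Complex.continuous_ofReal.comp (hη i)).smul continuous_const

lemma norm_weightedAverage_sub_le {p : ι → ℂ} {δ : ℝ} (h0 : ∀ i z, 0 ≤ η i z)
    (hd : ∀ i z, η i z ≠ 0 → dist z (p i) < δ) {z : ℂ} (h1 : ∑ i, η i z = 1) {v : ι → E} {u : E}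
    {c : ℝ} (hv : ∀ i, dist z (p i) < δ → ‖v i - u‖ ≤ c) : ‖weightedAverage η v z - u‖ ≤ c := by
  have hu : u = ∑ i, (η i z : ℂ) • u := by
    rw [← Finset.sum_smul, ← Complex.ofReal_sum, h1, Complex.ofReal_one, one_smul]
  rw [hu, weightedAverage, ← Finset.sum_sub_distrib]
  refine (norm_sum_le _ _).trans ?_
  calc _ ≤ ∑ i, η i z * c := by
        refine Finset.sum_le_sum fun i _ => ?_
        rw [← smul_sub, norm_smul, Complex.norm_real, Real.norm_of_nonneg (h0 i z)]
        by_cases hi : η i z = 0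
        · simp [hi]
        · exact mul_le_mul_of_nonneg_left (hv i (hd i z hi)) (h0 i z)
    _ = c := by rw [← Finset.sum_mul, h1, one_mul]

lemma norm_weightedAverage_le (h0 : ∀ i z, 0 ≤ η i z)
    {z : ℂ} (h1 : ∑ i, η i z = 1) {v : ι → E} {c : ℝ} (hv : ∀ i, ‖v i‖ ≤ c) :
    ‖weightedAverage η v z‖ ≤ c := by
  refine (norm_sum_le _ _).trans ?_
  calc _ ≤ ∑ i, η i z * c := by
        refine Finset.sum_le_sum fun i _ => ?_
        rw [norm_smul, Complex.norm_real, Real.norm_of_nonneg (h0 i z)]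
        exact mul_le_mul_of_nonneg_left (hv i) (h0 i z)
    _ = c := by rw [← Finset.sum_mul, h1, one_mul]

lemma exists_orthonormal_forall_inner_eq (v : ι → E) :
    ∃ (d : ℕ) (b : Fin d → E), Orthonormal ℂ b ∧
      ∀ (i : ι) (a : E), ∑ k, inner ℂ a (b k) * inner ℂ (b k) (v i) = inner ℂ a (v i) := by
  have hV : FiniteDimensional ℂ (Submodule.span ℂ (Set.range v)) :=
    FiniteDimensional.span_of_finite ℂ (Set.finite_range v)
  set B := stdOrthonormalBasis ℂ (Submodule.span ℂ (Set.range v)) with hB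
  refine ⟨_, fun k => (B k : E), ?_, fun i a => ?_⟩
  · exact B.orthonormal.comp_linearIsometry (Submodule.span ℂ (Set.range v)).subtypeₗᵢ
  · have h := congrArg (Subtype.val) (B.sum_repr' ⟨v i, Submodule.subset_span ⟨i, rfl⟩⟩)
    conv_rhs => rw [show v i = _ from h.symm]
    simp only [Submodule.coe_sum, Submodule.coe_smul, inner_sum, inner_smul_right,
      Submodule.coe_inner]
    exact Finset.sum_congr rfl fun k _ => mul_comm _ _

end WeightedAverage

section OperatorLipschitz

variable {H : Type*} [NormedAddCommGroup H] [InnerProductSpace ℂ H] [CompleteSpace H]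
  {E : Type*} [NormedAddCommGroup E] [InnerProductSpace ℂ E]
  {N₁ N₂ : H →L[ℂ] H} {d : ℕ} {b : Fin d → E}

lemma kernelTransform_sub_left {x x' y : ℂ → E} (hx : Continuous x) (hx' : Continuous x')
    (B : H →L[ℂ] H) : kernelTransform b N₁ N₂ (fun z => x z - x' z) y B =
      kernelTransform b N₁ N₂ x y B - kernelTransform b N₁ N₂ x' y B := by
  simp only [kernelTransform, inner_sub_left, ← Finset.sum_sub_distrib]
  refine Finset.sum_congr rfl fun k _ => ?_
  rw [cfc_sub _ _ N₁ (hx.inner continuous_const).continuousOn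
    (hx'.inner continuous_const).continuousOn, sub_mul, sub_mul]

lemma kernelTransform_sub_right {x y y' : ℂ → E} (hy : Continuous y) (hy' : Continuous y')
    (B : H →L[ℂ] H) : kernelTransform b N₁ N₂ x (fun z => y z - y' z) B =
      kernelTransform b N₁ N₂ x y B - kernelTransform b N₁ N₂ x y' B := by
  simp only [kernelTransform, inner_sub_right, ← Finset.sum_sub_distrib]
  refine Finset.sum_congr rfl fun k _ => ?_
  rw [cfc_sub _ _ N₂ (continuous_const.inner hy).continuousOn
    (continuous_const.inner hy').continuousOn, mul_sub]

lemma kernelTransform_sub {x y : ℂ → E} (A B : H →L[ℂ] H) :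
    kernelTransform b N₁ N₂ x y (A - B) =
      kernelTransform b N₁ N₂ x y A - kernelTransform b N₁ N₂ x y B := by
  simp only [kernelTransform, mul_sub, sub_mul, Finset.sum_sub_distrib]

lemma kernelTransform_cfc_left {x y : ℂ → E} (hx : Continuous x) {r : ℂ → ℝ} (hr : Continuous r) :
    kernelTransform b N₁ N₂ x y (cfc (fun z => (r z : ℂ)) N₁) =
      kernelTransform b N₁ N₂ (fun z => (r z : ℂ) • x z) y 1 := by
  refine Finset.sum_congr rfl fun k _ => ?_
  rw [mul_one, ← cfc_mul (fun z => inner ℂ (x z) (b k)) (fun z => (r z : ℂ)) N₁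
    (by fun_prop) (by fun_prop)]
  congr 2
  ext z
  rw [inner_smul_left, Complex.conj_ofReal, mul_comm]

lemma kernelTransform_cfc_right {x y : ℂ → E} (hy : Continuous y) {r : ℂ → ℝ} (hr : Continuous r) :
    kernelTransform b N₁ N₂ x y (cfc (fun z => (r z : ℂ)) N₂) =
      kernelTransform b N₁ N₂ x (fun z => (r z : ℂ) • y z) 1 := by
  refine Finset.sum_congr rfl fun k _ => ?_
  rw [mul_one, mul_assoc, ← cfc_mul (fun z => (r z : ℂ)) (fun z => inner ℂ (b k) (y z)) N₂
    (by fun_prop) (by fun_prop)]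
  congr 2
  ext z
  rw [inner_smul_right]

lemma cfc_weightedAverage {ι : Type} [Fintype ι] {η : ι → ℂ → ℝ} (hη : ∀ i, Continuous (η i))
    (a : ι → ℂ) (N : H →L[ℂ] H) :
    cfc (weightedAverage η a) N = ∑ i, a i • cfc (fun z => (η i z : ℂ)) N := by
  have h : weightedAverage η a = ∑ i, fun z => a i * (η i z : ℂ) := by
    ext z
    simp [weightedAverage, mul_comm]
  rw [h, cfc_sum (fun i z => a i * (η i z : ℂ)) N Finset.univ
    (fun i _ => (continuous_const.mul (Complex.continuous_ofReal.comp (hη i))).continuousOn)]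
  exact Finset.sum_congr rfl fun i _ => cfc_const_mul _ _ N
    (Complex.continuous_ofReal.comp (hη i)).continuousOn

lemma kernelTransform_weightedAverage {ι : Type} [Fintype ι] {η : ι → ℂ → ℝ}
    (hη : ∀ i, Continuous (η i)) (u v : ι → E)
    (hb : ∀ (i : ι) (a : E), ∑ k, inner ℂ a (b k) * inner ℂ (b k) (v i) = inner ℂ a (v i)) :
    kernelTransform b N₁ N₂ (weightedAverage η u) (weightedAverage η v) 1 =
      ∑ i, ∑ j, inner ℂ (u i) (v j) •
        (cfc (fun z => (η i z : ℂ)) N₁ * cfc (fun z => (η j z : ℂ)) N₂) := by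
  have h1 : ∀ k, cfc (fun z => inner ℂ (weightedAverage η u z) (b k)) N₁ =
      ∑ i, (inner ℂ (u i) (b k) : ℂ) • cfc (fun z => (η i z : ℂ)) N₁ := fun k => by
    rw [← cfc_weightedAverage hη]
    congr 1
    ext z
    simp [weightedAverage]
  have h2 : ∀ k, cfc (fun z => inner ℂ (b k) (weightedAverage η v z)) N₂ =
      ∑ i, (inner ℂ (b k) (v i) : ℂ) • cfc (fun z => (η i z : ℂ)) N₂ := fun k => by
    rw [← cfc_weightedAverage hη]
    congr 1
    ext z
    simp [weightedAverage]
  simp only [kernelTransform, h1, h2, mul_one, Finset.sum_mul_sum, smul_mul_smul_comm]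
  rw [Finset.sum_comm]
  refine Finset.sum_congr rfl fun i _ => ?_
  rw [Finset.sum_comm]
  refine Finset.sum_congr rfl fun j _ => ?_
  rw [← Finset.sum_smul, hb]

lemma TraceBound.cfc_re [IsStarNormal N₁] [IsStarNormal N₂] {c : ℝ} (h : TraceBound (N₁ - N₂) c) :
    TraceBound (cfc (fun z : ℂ => (z.re : ℂ)) N₁ - cfc (fun z : ℂ => (z.re : ℂ)) N₂) c := by
  have key : ∀ (N : H →L[ℂ] H) [IsStarNormal N],
      cfc (fun z : ℂ => (z.re : ℂ)) N = (1 / 2 : ℂ) • (N + star N) := by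
    intro N _
    have h1 : (fun z : ℂ => (z.re : ℂ)) = fun z => (1 / 2 : ℂ) * (z + star z) := by
      ext z
      rw [Complex.star_def, Complex.re_eq_add_conj]; ring
    rw [h1, cfc_const_mul _ (fun z => z + star z) N (by fun_prop),
      cfc_add N (fun z => z) (fun z => star z) continuousOn_id continuous_star.continuousOn,
      cfc_star (fun z => z), cfc_id' ℂ N]
  rw [key N₁, key N₂, ← smul_sub, add_sub_add_comm, ← star_sub]
  refine ((h.add h.adjoint).smul _).mono (le_of_eq ?_)
  norm_num; ring

lemma TraceBound.cfc_im [IsStarNormal N₁] [IsStarNormal N₂] {c : ℝ} (h : TraceBound (N₁ - N₂) c) :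
    TraceBound (cfc (fun z : ℂ => (z.im : ℂ)) N₁ - cfc (fun z : ℂ => (z.im : ℂ)) N₂) c := by
  have key : ∀ (N : H →L[ℂ] H) [IsStarNormal N],
      cfc (fun z : ℂ => (z.im : ℂ)) N = (-Complex.I / 2 : ℂ) • (N + (-1 : ℂ) • star N) := by
    intro N _
    have h1 : (fun z : ℂ => (z.im : ℂ)) = fun z => (-Complex.I / 2 : ℂ) * (z + (-1) * star z) := by
      ext z
      rw [Complex.star_def, Complex.im_eq_sub_conj]
      field_simp
      ring_nf
      simp
      ring
    rw [h1, cfc_const_mul _ (fun z => z + (-1) * star z) N (by fun_prop),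
      cfc_add N (fun z => z) (fun z => (-1) * star z) continuousOn_id
        (continuous_const.mul continuous_star).continuousOn,
      cfc_const_mul _ _ N continuous_star.continuousOn, cfc_star (fun z => z), cfc_id' ℂ N]
  rw [key N₁, key N₂, ← smul_sub, add_sub_add_comm, ← smul_sub, ← star_sub]
  refine ((h.add (h.adjoint.smul _)).smul _).mono (le_of_eq ?_)
  simp; ring

end OperatorLipschitz

section OperatorLipschitz

variable {H : Type*} [NormedAddCommGroup H] [InnerProductSpace ℂ H] [CompleteSpace H]
  {E : Type*} [NormedAddCommGroup E] [InnerProductSpace ℂ E] {N₁ N₂ : H →L[ℂ] H}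

lemma norm_smul_weightedAverage_sub_le {ι : Type} [Fintype ι] {p : ι → ℂ} {η : ι → ℂ → ℝ}
    {δ : ℝ} (h0 : ∀ i z, 0 ≤ η i z) (hd : ∀ i z, η i z ≠ 0 → dist z (p i) < δ) {r : ℂ → ℝ}
    (hrδ : ∀ i z, dist z (p i) < δ → |r z - r (p i)| ≤ δ) {u : ι → E} {C : ℝ}
    (hu : ∀ i, ‖u i‖ ≤ C) {z : ℂ} (h1 : ∑ i, η i z = 1) :
    ‖(r z : ℂ) • weightedAverage η u z -
      weightedAverage η (fun i => (r (p i) : ℂ) • u i) z‖ ≤ δ * C := by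
  have h : (r z : ℂ) • weightedAverage η u z -
      weightedAverage η (fun i => (r (p i) : ℂ) • u i) z =
      weightedAverage η (fun i => ((r z - r (p i) : ℝ) : ℂ) • u i) z - 0 := by
    rw [sub_zero]
    simp only [weightedAverage, Finset.smul_sum, ← Finset.sum_sub_distrib]
    refine Finset.sum_congr rfl fun i _ => ?_
    rw [smul_comm, ← smul_sub, ← sub_smul, Complex.ofReal_sub]
  rw [h]
  refine norm_weightedAverage_sub_le h0 hd h1 fun i hi => ?_
  rw [sub_zero, norm_smul, Complex.norm_real]
  exact mul_le_mul (hrδ i z hi) (hu i) (norm_nonneg _) ((abs_nonneg _).trans (hrδ i z hi))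

lemma exists_traceBound_norm_sub_le {ι : Type} [Fintype ι] {p : ι → ℂ} {η : ι → ℂ → ℝ}
    {δ : ℝ} (hδ : 0 < δ) (hη : ∀ i, Continuous (η i)) (h0 : ∀ i z, 0 ≤ η i z)
    (h1 : ∀ z ∈ spectrum ℂ N₁, ∑ i, η i z = 1) (h2 : ∀ z ∈ spectrum ℂ N₂, ∑ i, η i z = 1)
    (hd : ∀ i z, η i z ≠ 0 → dist z (p i) < δ) {r : ℂ → ℝ} (hr : Continuous r)
    (hrδ : ∀ i z, dist z (p i) < δ → |r z - r (p i)| ≤ δ) {X Y : ℂ → E} {C C' c : ℝ}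
    (hC : 0 ≤ C) (hC' : 0 ≤ C') (hX : ∀ z, ‖X z‖ ≤ C) (hY : ∀ z, ‖Y z‖ ≤ C')
    (h : TraceBound (cfc (fun z => (r z : ℂ)) N₁ - cfc (fun z => (r z : ℂ)) N₂) c) :
    ∃ G : H →L[ℂ] H, TraceBound G (C * C' * c) ∧
      ‖G - ∑ i, ∑ j, (((r (p i) : ℂ) - r (p j)) * inner ℂ (X (p i)) (Y (p j))) •
        (cfc (fun z => (η i z : ℂ)) N₁ * cfc (fun z => (η j z : ℂ)) N₂)‖ ≤ 2 * δ * C * C' := by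
  obtain ⟨d, b, hb, hbv⟩ := exists_orthonormal_forall_inner_eq (fun i => Y (p i))
  set x := weightedAverage η (fun i => X (p i)) with hx
  set y := weightedAverage η (fun i => Y (p i)) with hy
  set x' := weightedAverage η (fun i => (r (p i) : ℂ) • X (p i)) with hx'
  set y' := weightedAverage η (fun i => (r (p i) : ℂ) • Y (p i)) with hy'
  have hxc : Continuous x := continuous_weightedAverage hη _
  have hyc : Continuous y := continuous_weightedAverage hη _
  have hxc' : Continuous x' := continuous_weightedAverage hη _
  have hyc' : Continuous y' := continuous_weightedAverage hη _
  have hxC : ∀ z ∈ spectrum ℂ N₁, ‖x z‖ ≤ C := fun z hz =>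
    norm_weightedAverage_le h0 (h1 z hz) fun i => hX _
  have hyC : ∀ z ∈ spectrum ℂ N₂, ‖y z‖ ≤ C' := fun z hz =>
    norm_weightedAverage_le h0 (h2 z hz) fun i => hY _
  have hrx : Continuous fun z => (r z : ℂ) • x z := by fun_prop
  have hry : Continuous fun z => (r z : ℂ) • y z := by fun_prop
  refine ⟨kernelTransform b N₁ N₂ x y (cfc (fun z => (r z : ℂ)) N₁ - cfc (fun z => (r z : ℂ)) N₂),
    h.kernelTransform hb hxc hyc hC hC' hxC hyC, ?_⟩
  have hsum : ∑ i, ∑ j, (((r (p i) : ℂ) - r (p j)) * inner ℂ (X (p i)) (Y (p j))) •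
        (cfc (fun z => (η i z : ℂ)) N₁ * cfc (fun z => (η j z : ℂ)) N₂) =
      kernelTransform b N₁ N₂ x' y 1 - kernelTransform b N₁ N₂ x y' 1 := by
    rw [kernelTransform_weightedAverage hη _ _ hbv, kernelTransform_weightedAverage hη _ _
      (fun i a => by
        simp only [inner_smul_right, ← hbv i a, Finset.mul_sum]
        exact Finset.sum_congr rfl fun k _ => by ring)]
    simp only [← Finset.sum_sub_distrib, ← sub_smul, inner_smul_left, inner_smul_right,
      Complex.conj_ofReal, sub_mul]
  rw [hsum, kernelTransform_sub, kernelTransform_cfc_left hxc hr, kernelTransform_cfc_right hyc hr,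
    sub_sub_sub_comm, ← kernelTransform_sub_left hrx hxc', ← kernelTransform_sub_right hry hyc']
  refine (norm_sub_le _ _).trans ?_
  have e1 := norm_kernelTransform_one_le (N₁ := N₁) (N₂ := N₂) hb (hrx.sub hxc') hyc
    (mul_nonneg hδ.le hC) hC'
    (fun z hz => norm_smul_weightedAverage_sub_le h0 hd hrδ (fun i => hX _) (h1 z hz)) hyC
  have e2 := norm_kernelTransform_one_le (N₁ := N₁) (N₂ := N₂) hb hxc (hry.sub hyc') hC
    (mul_nonneg hδ.le hC') hxC
    (fun z hz => norm_smul_weightedAverage_sub_le h0 hd hrδ (fun i => hY _) (h2 z hz))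
  calc _ ≤ δ * C * C' + C * (δ * C') := add_le_add e1 e2
    _ = _ := by ring

lemma TraceBound.cfc_sub_of_factorization [IsStarNormal N₁] [IsStarNormal N₂] {f : ℂ → ℂ}
    (hf : Continuous f) {X₁ Y₁ X₂ Y₂ : ℂ → E} {C C' c : ℝ} (hC : 0 ≤ C) (hC' : 0 ≤ C')
    (hX₁ : ∀ z, ‖X₁ z‖ ≤ C) (hY₁ : ∀ z, ‖Y₁ z‖ ≤ C') (hX₂ : ∀ z, ‖X₂ z‖ ≤ C)
    (hY₂ : ∀ z, ‖Y₂ z‖ ≤ C')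
    (hfac : ∀ z w, f z - f w = ((z.re : ℂ) - w.re) * inner ℂ (X₁ z) (Y₁ w) +
      ((z.im : ℂ) - w.im) * inner ℂ (X₂ z) (Y₂ w))
    (h : TraceBound (N₁ - N₂) c) :
    TraceBound (cfc f N₁ - cfc f N₂) (2 * C * C' * c) := by
  have key : ∀ ε : ℝ, 0 < ε → ∃ G : H →L[ℂ] H, TraceBound G (2 * C * C' * c) ∧
      ‖G - (cfc f N₁ - cfc f N₂)‖ ≤ 4 * ε * C * C' + 2 * ε := by
    intro ε hε
    have hK : IsCompact (spectrum ℂ N₁ ∪ spectrum ℂ N₂) :=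
      (spectrum.isCompact N₁).union (spectrum.isCompact N₂)
    obtain ⟨δ', hδ', hunif⟩ := Metric.uniformContinuousOn_iff.1
      (hK.uniformContinuousOn_of_continuous hf.continuousOn) ε hε
    obtain ⟨ι, _, p, η, hp, hη, h0, hsum1, hd⟩ :=
      hK.exists_finite_partition (lt_min hε hδ')
    have h1 : ∀ z ∈ spectrum ℂ N₁, ∑ i, η i z = 1 := fun z hz => hsum1 z (Or.inl hz)
    have h2 : ∀ z ∈ spectrum ℂ N₂, ∑ i, η i z = 1 := fun z hz => hsum1 z (Or.inr hz)
    set δ := min ε δ' with hδdef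
    have hδ : 0 < δ := lt_min hε hδ'
    obtain ⟨G₁, hG₁, hn₁⟩ := exists_traceBound_norm_sub_le hδ hη h0 h1 h2 hd
      Complex.continuous_re (fun i z hz => by
        rw [← Complex.sub_re]
        exact (Complex.abs_re_le_norm _).trans (by rw [← dist_eq_norm]; exact hz.le))
      hC hC' hX₁ hY₁ h.cfc_re
    obtain ⟨G₂, hG₂, hn₂⟩ := exists_traceBound_norm_sub_le hδ hη h0 h1 h2 hd
      Complex.continuous_im (fun i z hz => by
        rw [← Complex.sub_im]
        exact (Complex.abs_im_le_norm _).trans (by rw [← dist_eq_norm]; exact hz.le))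
      hC hC' hX₂ hY₂ h.cfc_im
    refine ⟨G₁ + G₂, (hG₁.add hG₂).mono (le_of_eq (by ring)), ?_⟩
    have hcfc : ∀ (N : H →L[ℂ] H) [IsStarNormal N], (∀ z ∈ spectrum ℂ N, ∑ i, η i z = 1) →
        (∀ z ∈ spectrum ℂ N, z ∈ spectrum ℂ N₁ ∪ spectrum ℂ N₂) →
        ∑ i, cfc (fun z => (η i z : ℂ)) N = 1 ∧
        ‖∑ i, f (p i) • cfc (fun z => (η i z : ℂ)) N - cfc f N‖ ≤ ε := by
      intro N _ hN1 hNK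
      constructor
      · have := cfc_weightedAverage hη (fun _ => (1 : ℂ)) N
        simp only [one_smul] at this
        rw [← this, ← cfc_const_one ℂ N]
        refine cfc_congr fun z hz => ?_
        simp [weightedAverage, ← Complex.ofReal_sum, hN1 z hz]
      · rw [← cfc_weightedAverage hη, ← cfc_sub _ _ N
          (continuous_weightedAverage hη _).continuousOn hf.continuousOn]
        refine norm_cfc_le hε.le fun z hz => ?_
        refine norm_weightedAverage_sub_le h0 hd (hN1 z hz) fun i hi => ?_
        rw [← dist_eq_norm, dist_comm]
        exact (hunif z (hNK z hz) _ (hp i) (hi.trans_le (min_le_right _ _))).le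
    obtain ⟨u1, v1⟩ := hcfc N₁ h1 fun z hz => Or.inl hz
    obtain ⟨u2, v2⟩ := hcfc N₂ h2 fun z hz => Or.inr hz
    set P : ι → H →L[ℂ] H := fun i => cfc (fun z => (η i z : ℂ)) N₁ with hP
    set Q : ι → H →L[ℂ] H := fun i => cfc (fun z => (η i z : ℂ)) N₂ with hQ
    have hdec : ∑ i, ∑ j, ((((p i).re : ℂ) - (p j).re) * inner ℂ (X₁ (p i)) (Y₁ (p j))) •
          (P i * Q j) +
        ∑ i, ∑ j, ((((p i).im : ℂ) - (p j).im) * inner ℂ (X₂ (p i)) (Y₂ (p j))) • (P i * Q j) =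
        ∑ i, f (p i) • P i - ∑ i, f (p i) • Q i := by
      have e1 : ∑ i, f (p i) • P i = ∑ i, ∑ j, f (p i) • (P i * Q j) := by
        refine Finset.sum_congr rfl fun i _ => ?_
        rw [← Finset.smul_sum, ← Finset.mul_sum, u2, mul_one]
      have e2 : ∑ j, f (p j) • Q j = ∑ i, ∑ j, f (p j) • (P i * Q j) := by
        rw [Finset.sum_comm]
        refine Finset.sum_congr rfl fun i _ => ?_
        rw [← Finset.smul_sum, ← Finset.sum_mul, u1, one_mul]
      rw [e1, e2]
      simp only [← Finset.sum_add_distrib, ← Finset.sum_sub_distrib, ← add_smul, ← sub_smul, hfac]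
    calc ‖G₁ + G₂ - (cfc f N₁ - cfc f N₂)‖
        = ‖(G₁ - ∑ i, ∑ j, ((((p i).re : ℂ) - (p j).re) * inner ℂ (X₁ (p i)) (Y₁ (p j))) •
              (P i * Q j)) +
            (G₂ - ∑ i, ∑ j, ((((p i).im : ℂ) - (p j).im) * inner ℂ (X₂ (p i)) (Y₂ (p j))) •
              (P i * Q j)) + ((∑ i, f (p i) • P i - cfc f N₁) -
              (∑ i, f (p i) • Q i - cfc f N₂))‖ := by
          congr 1
          rw [sub_sub_sub_comm (∑ i, f (p i) • P i), ← hdec]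
          abel
      _ ≤ (2 * δ * C * C' + 2 * δ * C * C') + (ε + ε) :=
          (norm_add_le _ _).trans (add_le_add ((norm_add_le _ _).trans (add_le_add hn₁ hn₂))
            ((norm_sub_le _ _).trans (add_le_add v1 v2)))
      _ = 4 * δ * C * C' + 2 * ε := by ring
      _ ≤ _ := by gcongr; exact min_le_left _ _
  choose G hG hGn using fun n : ℕ => key (1 / (n + 1)) (by positivity)
  refine TraceBound.of_tendsto hG (tendsto_iff_norm_sub_tendsto_zero.2 ?_)
  refine squeeze_zero (fun _ => norm_nonneg _) hGn ?_
  have ht := tendsto_one_div_add_atTop_nhds_zero_nat (𝕜 := ℝ)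
  simpa using (((ht.const_mul 4).mul_const C).mul_const C').add (ht.const_mul 2)

end OperatorLipschitz

/-- The character `t ↦ exp (2πit)`. -/
noncomputable def expTwoPi (t : ℝ) : ℂ := Complex.exp ((2 * Real.pi * t : ℝ) * Complex.I)

lemma norm_expTwoPi (t : ℝ) : ‖expTwoPi t‖ = 1 := Complex.norm_exp_ofReal_mul_I _

lemma continuous_expTwoPi : Continuous expTwoPi := by
  unfold expTwoPi; fun_prop

lemma expTwoPi_add (s t : ℝ) : expTwoPi (s + t) = expTwoPi s * expTwoPi t := by
  rw [expTwoPi, expTwoPi, expTwoPi, ← Complex.exp_add]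
  congr 1
  push_cast
  ring

lemma intervalIntegral_expTwoPi (a b : ℝ) :
    ∫ t in (0 : ℝ)..1, 2 * Real.pi * Complex.I * (b - a) * (expTwoPi ((1 - t) * a) *
      expTwoPi (t * b)) = expTwoPi b - expTwoPi a := by
  rcases eq_or_ne a b with rfl | hab
  · simp
  have hc : 2 * Real.pi * Complex.I * ((b : ℂ) - a) ≠ 0 := by
    have : (b : ℂ) - a ≠ 0 := sub_ne_zero.2 (by exact_mod_cast hab.symm)
    simp [Real.pi_ne_zero, this]
  have h : ∀ t : ℝ, 2 * Real.pi * Complex.I * (b - a) * (expTwoPi ((1 - t) * a) *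
      expTwoPi (t * b)) = 2 * Real.pi * Complex.I * (b - a) * expTwoPi a *
        Complex.exp (2 * Real.pi * Complex.I * (b - a) * t) := by
    intro t
    rw [mul_assoc (_ * _) (expTwoPi a)]
    congr 1
    simp only [expTwoPi, ← Complex.exp_add]
    congr 1
    push_cast
    ring
  simp_rw [h]
  have hcancel : ∀ c e D : ℂ, c ≠ 0 → c * e * (D / c) = e * D := fun c e D h => by field_simp
  rw [intervalIntegral.integral_const_mul, integral_exp_mul_complex hc, hcancel _ _ _ hc]
  simp only [expTwoPi]
  simp only [Complex.ofReal_one, Complex.ofReal_zero, mul_one, mul_zero, Complex.exp_zero, mul_sub,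
    ← Complex.exp_add]
  congr 2
  push_cast
  ring

lemma exists_schwartz_integral_eq_one : ∃ ρ : SchwartzMap ℝ ℂ, ∀ l : ℝ, |l| ≤ 1 →
    ∫ v, ρ v * expTwoPi (-(l * v)) = 1 := by
  let B : ContDiffBump (0 : ℝ) := ⟨1, 2, one_pos, one_lt_two⟩
  have hc : HasCompactSupport (fun x => (B x : ℂ)) :=
    B.hasCompactSupport.comp_left (g := Complex.ofReal) (by simp)
  have hd : ContDiff ℝ (⊤ : ℕ∞) (fun x => (B x : ℂ)) := Complex.ofRealCLM.contDiff.comp B.contDiff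
  set φ : SchwartzMap ℝ ℂ := hc.toSchwartzMap hd with hφ
  refine ⟨𝓕⁻ φ, fun l hl => ?_⟩
  have h1 : 𝓕 (𝓕⁻ φ) l = φ l := by rw [FourierTransform.fourier_fourierInv_eq]
  have h2 : φ l = 1 := by
    have : B l = 1 := B.one_of_mem_closedBall (by simpa using hl)
    simp [hφ, this]
  rw [← h2, ← h1, SchwartzMap.fourier_coe, Real.fourier_real_eq_integral_exp_smul]
  refine integral_congr_ae (Eventually.of_forall fun v => ?_)
  dsimp only
  rw [smul_eq_mul, mul_comm, expTwoPi]
  congr 4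
  ring

section TrigIntegral

variable {Ω : Type*} [MeasurableSpace Ω]

/-- The superposition `v ↦ ∫ G ω * exp (2πi l(ω) v) dμ(ω)` of characters of the line. -/
noncomputable def trigIntegral (μ : Measure Ω) (G : Ω → ℂ) (l : Ω → ℝ) (v : ℝ) : ℂ :=
  ∫ ω, G ω * expTwoPi (l ω * v) ∂μ

variable {μ : Measure Ω} {G : Ω → ℂ} {l : Ω → ℝ}

lemma Integrable.mul_expTwoPi (hG : Integrable G μ) (hl : Measurable l) :
    Integrable (fun ω => G ω * expTwoPi (l ω)) μ :=
  hG.mul_bdd (c := 1) (continuous_expTwoPi.measurable.comp hl).aestronglyMeasurable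
    (Eventually.of_forall fun _ => (norm_expTwoPi _).le)

lemma norm_trigIntegral_le (v : ℝ) : ‖trigIntegral μ G l v‖ ≤ ∫ ω, ‖G ω‖ ∂μ := by
  refine (norm_integral_le_integral_norm _).trans (le_of_eq ?_)
  simp [norm_expTwoPi]

lemma continuous_trigIntegral (hG : Integrable G μ) (hl : Measurable l) :
    Continuous (trigIntegral μ G l) := by
  refine continuous_of_dominated (bound := fun ω => ‖G ω‖)
    (fun v => (Integrable.mul_expTwoPi hG (hl.mul_const v)).aestronglyMeasurable)
    (fun v => Eventually.of_forall fun ω => by simp [norm_expTwoPi]) hG.norm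
    (Eventually.of_forall fun ω => ?_)
  exact continuous_const.mul (continuous_expTwoPi.comp (continuous_const.mul continuous_id))

lemma integral_mul_trigIntegral [SFinite μ] (hG : Integrable G μ) (hl : Measurable l)
    (hl1 : ∀ ω, G ω ≠ 0 → |l ω| ≤ 1) {ρ : SchwartzMap ℝ ℂ}
    (hρ : ∀ t : ℝ, |t| ≤ 1 → ∫ v, ρ v * expTwoPi (-(t * v)) = 1) (x : ℝ) :
    ∫ v, ρ (x - v) * trigIntegral μ G l v = trigIntegral μ G l x := by
  have hint : Integrable (Function.uncurry fun (v : ℝ) (ω : Ω) =>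
      ρ (x - v) * (G ω * expTwoPi (l ω * v))) (volume.prod μ) := by
    have h1 : Integrable (fun p : ℝ × Ω => ρ (x - p.1) * G p.2) (volume.prod μ) :=
      Integrable.mul_prod (f := fun v => ρ (x - v)) (ρ.integrable.comp_sub_left x) hG
    refine (Integrable.mul_expTwoPi h1 (l := fun p => l p.2 * p.1)
      ((hl.comp measurable_snd).mul measurable_fst)).congr (Eventually.of_forall fun p => ?_)
    simp only [Function.uncurry, mul_assoc]
  simp only [trigIntegral, ← integral_const_mul]
  rw [integral_integral_swap hint]
  refine integral_congr_ae (Eventually.of_forall fun ω => ?_)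
  dsimp only
  by_cases hω : G ω = 0
  · simp [hω]
  rw [← integral_sub_left_eq_self _ volume x]
  have h2 : ∀ v, ρ (x - (x - v)) * (G ω * expTwoPi (l ω * (x - v))) =
      G ω * expTwoPi (l ω * x) * (ρ v * expTwoPi (-(l ω * v))) := by
    intro v
    rw [sub_sub_cancel, mul_sub, sub_eq_add_neg, expTwoPi_add]
    ring
  simp_rw [h2]
  rw [integral_const_mul, hρ _ (hl1 ω hω), mul_one]

lemma exists_trigIntegral_mul_sub_eq [SFinite μ] (hG : Integrable G μ) (hl : Measurable l)
    (hl1 : ∀ ω, G ω ≠ 0 → |l ω| ≤ 1) {ρ : SchwartzMap ℝ ℂ}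
    (hρ : ∀ t : ℝ, |t| ≤ 1 → ∫ v, ρ v * expTwoPi (-(t * v)) = 1) (c : ℝ) :
    ∃ h : ℝ → ℂ, Continuous h ∧ (∃ S, ∀ v, ‖h v‖ ≤ S) ∧
      (∀ v : ℝ, ((v : ℂ) - c) * h v = trigIntegral μ G l v - trigIntegral μ G l c) ∧
      ∀ x, ∫ v, ρ (x - v) * h v = h x := by
  set G' : Ω × unitInterval → ℂ := fun p =>
    (G p.1 * (2 * Real.pi * Complex.I * l p.1)) * expTwoPi ((1 - (p.2 : ℝ)) * (l p.1 * c)) with hG'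
  set l' : Ω × unitInterval → ℝ := fun p => p.2 * l p.1 with hl'
  have hl'm : Measurable l' := by fun_prop
  have hGl : Integrable (fun ω => G ω * (2 * Real.pi * Complex.I * l ω)) μ := by
    refine (hG.norm.const_mul (2 * Real.pi)).mono
      (hG.aestronglyMeasurable.mul (by fun_prop)) (Eventually.of_forall fun ω => ?_)
    rcases eq_or_ne (G ω) 0 with h | h
    · simp [h]
    · simp only [norm_mul, Complex.norm_ofNat, Complex.norm_real, Complex.norm_I, norm_norm,
        Real.norm_ofNat, mul_one]
      rw [mul_comm]
      have := hl1 ω h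
      rw [← Real.norm_eq_abs] at this
      have h2 : 2 * ‖Real.pi‖ * ‖l ω‖ ≤ 2 * ‖Real.pi‖ * 1 := by gcongr
      rw [mul_one] at h2
      gcongr
  have hG'i : Integrable G' (μ.prod volume) := by
    refine Integrable.mul_expTwoPi (hGl.comp_fst volume) ?_
    fun_prop
  refine ⟨trigIntegral (μ.prod volume) G' l', continuous_trigIntegral hG'i hl'm,
    ⟨_, norm_trigIntegral_le⟩, fun v => ?_, integral_mul_trigIntegral hG'i hl'm ?_ hρ⟩
  · rw [trigIntegral, integral_prod _ (Integrable.mul_expTwoPi hG'i (hl'm.mul_const v)),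
      trigIntegral, trigIntegral, ← integral_sub (Integrable.mul_expTwoPi hG (hl.mul_const v))
      (Integrable.mul_expTwoPi hG (hl.mul_const c)), ← integral_const_mul]
    refine integral_congr_ae (Eventually.of_forall fun ω => ?_)
    dsimp only
    rw [← mul_sub, ← intervalIntegral_expTwoPi, ← integral_const_mul,
      intervalIntegral.integral_of_le zero_le_one, ← integral_Icc_eq_integral_Ioc,
      ← integral_const_mul, ← integral_subtype_comap measurableSet_Icc]
    refine integral_congr_ae (Eventually.of_forall fun t => ?_)
    simp only [hG', hl']
    push_cast
    rw [mul_assoc (t : ℝ)]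
    ring
  · rintro ⟨ω, t⟩ h
    have hω : G ω ≠ 0 := fun h0 => h (by simp [hG', h0])
    rw [hl', abs_mul, abs_of_nonneg t.2.1]
    exact mul_le_one₀ t.2.2 (abs_nonneg _) (hl1 ω hω)

end TrigIntegral

lemma exists_norm_sq_le_of_reproducing (ρ : SchwartzMap ℝ ℂ) : ∃ D : ℝ, 0 ≤ D ∧
    ∀ (g h : ℝ → ℂ) (B c S : ℝ), (∀ v, ‖g v‖ ≤ B) → (∀ v, ‖h v‖ ≤ S) →
      (∀ v : ℝ, ((v : ℂ) - c) * h v = g v - g c) → (∀ x, ∫ v, ρ (x - v) * h v = h x) →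
      ∀ v, ‖h v‖ ^ 2 ≤ D * B ^ 2 * (1 + (v - c) ^ 2)⁻¹ := by
  obtain ⟨P, hP0, hP⟩ : ∃ P : ℝ, 0 < P ∧ ∀ x, ‖ρ x‖ ≤ P :=
    ⟨SchwartzMap.seminorm ℝ 0 0 ρ + 1, by positivity, fun x =>
      (SchwartzMap.norm_le_seminorm ℝ ρ x).trans (by linarith)⟩
  set I := ∫ v, ‖ρ v‖ with hI
  refine ⟨(16 * P * I) ^ 2 + 4, by positivity, fun g h B c S₀ hg hS₀ hgh hrep => ?_⟩
  have hB : 0 ≤ B := (norm_nonneg _).trans (hg 0)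
  have hgh' : ∀ v, |v - c| * ‖h v‖ ≤ 2 * B := fun v => by
    have h1 : ‖((v : ℂ) - c) * h v‖ ≤ 2 * B := by
      rw [hgh]
      linarith [norm_sub_le (g v) (g c), hg v, hg c]
    rwa [norm_mul, ← Complex.ofReal_sub, Complex.norm_real] at h1
  have hbdd : BddAbove (Set.range fun v => ‖h v‖) := ⟨S₀, by rintro _ ⟨v, rfl⟩; exact hS₀ v⟩
  set S := ⨆ v, ‖h v‖ with hS
  have hSv : ∀ v, ‖h v‖ ≤ S := le_ciSup hbdd
  have hS0 : 0 ≤ S := (norm_nonneg _).trans (hSv 0)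
  set δ : ℝ := 1 / (4 * P) with hδ
  have hδ0 : 0 < δ := by positivity
  have hself : ∀ x, ‖h x‖ ≤ 8 * P * I * B + S / 2 := by
    intro x
    rw [← hrep x]
    refine (norm_integral_le_of_norm_le (g := fun v => 8 * P * B * ‖ρ (x - v)‖ +
      (Set.Icc (c - δ) (c + δ)).indicator (fun _ => P * S) v) ?_
      (Eventually.of_forall fun v => ?_)).trans (le_of_eq ?_)
    · refine ((ρ.integrable.comp_sub_left x).norm.const_mul _).add ?_
      exact (integrable_indicator_iff measurableSet_Icc).2 (integrableOn_const (by simp))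
    · rw [norm_mul]
      by_cases hv : v ∈ Set.Icc (c - δ) (c + δ)
      · rw [Set.indicator_of_mem hv]
        have := mul_le_mul (hP (x - v)) (hSv v) (norm_nonneg _) hP0.le
        have : 0 ≤ 8 * P * B * ‖ρ (x - v)‖ := by positivity
        linarith
      · rw [Set.indicator_of_notMem hv, add_zero, mul_comm]
        refine mul_le_mul_of_nonneg_right ?_ (norm_nonneg _)
        have hd : δ ≤ |v - c| := by
          by_contra! hlt
          rw [abs_lt] at hlt
          exact hv ⟨by linarith, by linarith⟩
        have h1 := (mul_le_mul_of_nonneg_right hd (norm_nonneg (h v))).trans (hgh' v)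
        rw [hδ, div_mul_eq_mul_div, one_mul, div_le_iff₀ (by positivity)] at h1
        linarith
    · rw [integral_add ((ρ.integrable.comp_sub_left x).norm.const_mul _)
        ((integrable_indicator_iff measurableSet_Icc).2 (integrableOn_const (by simp))),
        integral_const_mul, integral_sub_left_eq_self (fun v => ‖ρ v‖), integral_indicator measurableSet_Icc,
        setIntegral_const, Real.volume_real_Icc_of_le (by linarith), smul_eq_mul, ← hI]
      have : c + δ - (c - δ) = 1 / (2 * P) := by rw [hδ]; field_simp; ring
      rw [this]
      field_simp
  have hSle : S ≤ 16 * P * I * B := by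
    have := ciSup_le hself
    linarith
  intro v
  rw [← div_eq_mul_inv, le_div_iff₀ (by positivity)]
  have h1 : ‖h v‖ ^ 2 ≤ (16 * P * I * B) ^ 2 :=
    pow_le_pow_left₀ (norm_nonneg _) ((hSv v).trans hSle) 2
  have h2 : (|v - c| * ‖h v‖) ^ 2 ≤ (2 * B) ^ 2 :=
    pow_le_pow_left₀ (by positivity) (hgh' v) 2
  rw [mul_pow, sq_abs] at h2
  linarith

lemma exists_Lp_two_of_norm_sq_le {h : ℝ → ℂ} (hc : AEStronglyMeasurable h) {K c : ℝ}
    (hK : ∀ v, ‖h v‖ ^ 2 ≤ K * (1 + (v - c) ^ 2)⁻¹) :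
    ∃ F : Lp ℂ 2 (volume : Measure ℝ), F =ᵐ[volume] h ∧ ‖F‖ ≤ √(K * Real.pi) := by
  have hi : Integrable (fun v : ℝ => K * (1 + (v - c) ^ 2)⁻¹) :=
    (integrable_inv_one_add_sq.comp_sub_right c).const_mul K
  have hi2 : Integrable (fun v => ‖h v‖ ^ 2) := hi.mono (hc.norm.pow 2)
    (Eventually.of_forall fun v => by
      rw [Real.norm_of_nonneg (by positivity)]
      exact (hK v).trans (le_abs_self _))
  have hmem : MemLp h 2 volume := (memLp_two_iff_integrable_sq_norm hc).2 hi2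
  refine ⟨hmem.toLp, hmem.coeFn_toLp, Real.le_sqrt_of_sq_le ?_⟩
  have h1 : (‖hmem.toLp‖ ^ 2 : ℝ) = ∫ v, ‖h v‖ ^ 2 := by
    have h2 : ((‖hmem.toLp‖ ^ 2 : ℝ) : ℂ) = ((∫ v, ‖h v‖ ^ 2 : ℝ) : ℂ) := by
      push_cast
      refine (inner_self_eq_norm_sq_to_K (𝕜 := ℂ) hmem.toLp).symm.trans ?_
      rw [L2.inner_def, ← integral_complex_ofReal]
      refine integral_congr_ae (hmem.coeFn_toLp.mono fun v hv => ?_)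
      dsimp only
      rw [hv, inner_self_eq_norm_sq_to_K]
      push_cast
      rfl
    exact_mod_cast h2
  rw [h1, ← integral_univ_inv_one_add_sq,
    ← integral_sub_right_eq_self (fun v : ℝ => (1 + v ^ 2)⁻¹) c, ← integral_const_mul]
  exact integral_mono hi2 hi hK

lemma exists_norm_sq_schwartz_le (ρ : SchwartzMap ℝ ℂ) : ∃ K : ℝ, 0 ≤ K ∧
    ∀ x v, ‖ρ (x - v)‖ ^ 2 ≤ K * (1 + (v - x) ^ 2)⁻¹ := by
  refine ⟨(SchwartzMap.seminorm ℝ 0 0 ρ) ^ 2 + (SchwartzMap.seminorm ℝ 1 0 ρ) ^ 2, by positivity,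
    fun x v => ?_⟩
  rw [← div_eq_mul_inv, le_div_iff₀ (by positivity)]
  have h0 := pow_le_pow_left₀ (norm_nonneg _) (SchwartzMap.norm_le_seminorm ℝ ρ (x - v)) 2
  have h1 := pow_le_pow_left₀ (by positivity) (SchwartzMap.norm_pow_mul_le_seminorm ℝ ρ 1 (x - v)) 2
  rw [mul_pow, pow_one, Real.norm_eq_abs, sq_abs] at h1
  nlinarith

lemma exists_inner_eq_trigIntegral_sub : ∃ (C : ℝ) (R R' : ℝ → Lp ℂ 2 (volume : Measure ℝ)),
    0 < C ∧ (∀ x, ‖R x‖ ≤ C) ∧ (∀ x, ‖R' x‖ ≤ C) ∧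
    ∀ {Ω : Type} [MeasurableSpace Ω] (μ : Measure Ω) [SFinite μ] (G : Ω → ℂ) (l : Ω → ℝ) (B c : ℝ),
      Integrable G μ → Measurable l → (∀ ω, G ω ≠ 0 → |l ω| ≤ 1) →
      (∀ v, ‖trigIntegral μ G l v‖ ≤ B) →
      ∃ F F' : Lp ℂ 2 (volume : Measure ℝ), ‖F‖ ≤ C * B ∧ ‖F'‖ ≤ C * B ∧
        ∀ x : ℝ, trigIntegral μ G l x - trigIntegral μ G l c = ((x : ℂ) - c) * inner ℂ (R x) F ∧
          trigIntegral μ G l x - trigIntegral μ G l c = ((x : ℂ) - c) * inner ℂ F' (R' x) := by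
  obtain ⟨ρ, hρ⟩ := exists_schwartz_integral_eq_one
  obtain ⟨D, hD0, hD⟩ := exists_norm_sq_le_of_reproducing ρ
  obtain ⟨K, hK0, hK⟩ := exists_norm_sq_schwartz_le ρ
  have hρc : ∀ x : ℝ, Continuous fun v => ρ (x - v) := fun x => by fun_prop
  choose R' hR' hR'n using fun x => exists_Lp_two_of_norm_sq_le
    (hρc x).aestronglyMeasurable (hK x)
  choose R hR hRn using fun x => exists_Lp_two_of_norm_sq_le (h := fun v => star (ρ (x - v)))
    (hρc x).star.aestronglyMeasurable (by simpa using hK x)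
  refine ⟨√(K * Real.pi) + √(D * Real.pi) + 1, R, R', by positivity,
    fun x => (hRn x).trans (by linarith [Real.sqrt_nonneg (D * Real.pi)]),
    fun x => (hR'n x).trans (by linarith [Real.sqrt_nonneg (D * Real.pi)]), ?_⟩
  intro Ω _ μ _ G l B c hG hl hl1 hB
  have hB0 : 0 ≤ B := (norm_nonneg _).trans (hB 0)
  obtain ⟨h, hc, ⟨S, hS⟩, hgh, hrep⟩ := exists_trigIntegral_mul_sub_eq hG hl hl1 hρ c
  have hh := hD _ h B c S hB hS hgh hrep
  obtain ⟨F, hF, hFn⟩ := exists_Lp_two_of_norm_sq_le hc.aestronglyMeasurable hh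
  obtain ⟨F', hF', hFn'⟩ := exists_Lp_two_of_norm_sq_le (h := fun v => star (h v))
    hc.star.aestronglyMeasurable (by simpa using hh)
  have hn : √(D * B ^ 2 * Real.pi) ≤ (√(K * Real.pi) + √(D * Real.pi) + 1) * B := by
    rw [show D * B ^ 2 * Real.pi = D * Real.pi * B ^ 2 by ring, Real.sqrt_mul (by positivity),
      Real.sqrt_sq hB0]
    gcongr
    linarith [Real.sqrt_nonneg (K * Real.pi)]
  refine ⟨F, F', hFn.trans hn, hFn'.trans hn, fun x => ⟨?_, ?_⟩⟩
  · rw [← hgh, L2.inner_def, ← hrep x]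
    congr 1
    refine integral_congr_ae ?_
    filter_upwards [hR x, hF] with v h1 h2
    rw [h1, h2]
    simp [mul_comm]
  · rw [← hgh, L2.inner_def, ← hrep x]
    congr 1
    refine integral_congr_ae ?_
    filter_upwards [hR' x, hF'] with v h1 h2
    rw [h1, h2]
    simp [mul_comm]

lemma exists_factorization_planeTrigIntegral : ∃ C : ℝ, 0 < C ∧
    ∀ {Ω : Type} [MeasurableSpace Ω] (μ : Measure Ω) [SFinite μ] (G : Ω → ℂ) (l m : Ω → ℝ)
      (f : ℂ → ℂ) (B : ℝ), Integrable G μ → Measurable l → Measurable m →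
      (∀ ω, G ω ≠ 0 → |l ω| ≤ 1) → (∀ ω, G ω ≠ 0 → |m ω| ≤ 1) →
      (∀ z, f z = ∫ ω, G ω * expTwoPi (l ω * z.re + m ω * z.im) ∂μ) → 0 < B → (∀ z, ‖f z‖ ≤ B) →
      ∃ X₁ Y₁ X₂ Y₂ : ℂ → Lp ℂ 2 (volume : Measure ℝ), (∀ z, ‖X₁ z‖ ≤ C) ∧ (∀ z, ‖Y₁ z‖ ≤ C * B) ∧
        (∀ z, ‖X₂ z‖ ≤ C) ∧ (∀ z, ‖Y₂ z‖ ≤ C * B) ∧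
        ∀ z w, f z - f w = ((z.re : ℂ) - w.re) * inner ℂ (X₁ z) (Y₁ w) +
          ((z.im : ℂ) - w.im) * inner ℂ (X₂ z) (Y₂ w) := by
  obtain ⟨C, R, R', hC, hR, hR', key⟩ := exists_inner_eq_trigIntegral_sub
  refine ⟨C, hC, ?_⟩
  intro Ω _ μ _ G l m f B hG hl hm hl1 hm1 hf hB hfB
  have e1 : ∀ x y : ℝ, trigIntegral μ (fun ω => G ω * expTwoPi (m ω * y)) l x = f ⟨x, y⟩ := by
    intro x y
    rw [hf, trigIntegral]
    refine integral_congr_ae (Eventually.of_forall fun ω => ?_)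
    dsimp only
    rw [expTwoPi_add]; ring
  have e2 : ∀ x y : ℝ, trigIntegral μ (fun ω => G ω * expTwoPi (l ω * x)) m y = f ⟨x, y⟩ := by
    intro x y
    rw [hf, trigIntegral]
    refine integral_congr_ae (Eventually.of_forall fun ω => ?_)
    dsimp only
    rw [expTwoPi_add]; ring
  choose F _ hF _ hFe using fun w : ℂ => key μ (fun ω => G ω * expTwoPi (m ω * w.im)) l B w.re
    (Integrable.mul_expTwoPi hG (hm.mul_const _)) hl (fun ω hω => hl1 ω (left_ne_zero_of_mul hω))
    (fun v => by rw [e1]; exact hfB _)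
  choose _ F' _ hF' hFe' using fun z : ℂ => key μ (fun ω => G ω * expTwoPi (l ω * z.re)) m B z.im
    (Integrable.mul_expTwoPi hG (hl.mul_const _)) hm (fun ω hω => hm1 ω (left_ne_zero_of_mul hω))
    (fun v => by rw [e2]; exact hfB _)
  refine ⟨fun z => R z.re, F, fun z => ((B⁻¹ : ℝ) : ℂ) • F' z, fun w => (B : ℂ) • R' w.im,
    fun z => hR _, hF, fun z => ?_, fun z => ?_, fun z w => ?_⟩
  · rw [norm_smul, Complex.norm_real, Real.norm_of_nonneg (by positivity), inv_mul_le_iff₀ hB]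
    linarith [hF' z]
  · rw [norm_smul, Complex.norm_real, Real.norm_of_nonneg hB.le, mul_comm]
    gcongr
    exact hR' _
  · have h1 := (hFe w z.re).1
    have h2 := (hFe' z w.im).2
    rw [e1, e1] at h1
    rw [e2, e2] at h2
    have hBc : (B : ℂ) ≠ 0 := by exact_mod_cast hB.ne'
    have h3 : inner ℂ (((B⁻¹ : ℝ) : ℂ) • F' z) ((B : ℂ) • R' w.im) = inner ℂ (F' z) (R' w.im) := by
      rw [inner_smul_left, inner_smul_right, Complex.conj_ofReal]
      push_cast
      field_simp
    rw [h3, ← h1]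
    have h4 : f z - f ⟨z.re, w.im⟩ = ((z.im : ℂ) - w.im) * inner ℂ (F' z) (R' w.im) := by
      rw [← neg_sub, show f z = f ⟨z.re, z.im⟩ from rfl, h2]; ring
    rw [← h4, show f ⟨w.re, w.im⟩ = f w from rfl]
    ring

lemma norm_expTwoPi_sub_one_le (t : ℝ) : ‖expTwoPi t - 1‖ ≤ 2 * Real.pi * |t| := by
  rw [expTwoPi, mul_comm]
  refine Real.norm_exp_I_mul_ofReal_sub_one_le.trans (le_of_eq ?_)
  rw [Real.norm_eq_abs, abs_mul, abs_of_pos Real.two_pi_pos]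

/-- A mollified cutoff `κ` with Fourier transform a bump function of radius `ε`, such that
multiplication by `κ` enlarges Fourier supports by at most `ε`. -/
lemma exists_integrable_cutoff {ε : ℝ} (hε : 0 < ε) : ∃ κ : ℂ → ℂ, Continuous κ ∧ Integrable κ ∧
    (∀ z, ‖κ z‖ ≤ 1) ∧ (∀ z, ‖κ z - 1‖ ≤ 2 * Real.pi * ε * ‖z‖) ∧
    ∀ (f : ℂ → ℂ) (σ : ℝ), FourierSupportedIn f σ → ∀ ξ, σ + ε < ‖ξ‖ →
      ∫ z, f z * κ z * expTwoPi (-inner ℝ z ξ) = 0 := by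
  let b : ContDiffBump (0 : ℂ) := ⟨ε / 2, ε, half_pos hε, half_lt_self hε⟩
  set ψ : ℂ → ℂ := fun x => (b.normed volume x : ℂ) with hψ
  have hψs : tsupport ψ ⊆ Metric.closedBall 0 ε := by
    refine (tsupport_comp_subset (g := Complex.ofReal) (by simp) (b.normed volume)).trans ?_
    rw [b.tsupport_normed_eq]
  have hc : HasCompactSupport ψ :=
    b.hasCompactSupport_normed.comp_left (g := Complex.ofReal) (by simp)
  have hd : ContDiff ℝ (⊤ : ℕ∞) ψ := Complex.ofRealCLM.contDiff.comp b.contDiff_normed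
  set φ : SchwartzMap ℂ ℂ := hc.toSchwartzMap hd with hφ
  have hφψ : ∀ x, φ x = ψ x := fun x => by simp [hφ]
  have h1 : ∫ x, ‖φ x‖ = 1 := by
    rw [← b.integral_normed (μ := volume)]
    refine integral_congr_ae (Eventually.of_forall fun x => ?_)
    dsimp only
    rw [hφψ, hψ, Complex.norm_real, Real.norm_of_nonneg (b.nonneg_normed x)]
  have h1' : ∫ x, φ x = 1 := by
    simp_rw [hφψ, hψ]
    rw [integral_complex_ofReal, b.integral_normed, Complex.ofReal_one]
  have hF : ∀ (g : ℂ → ℂ) (z : ℂ), 𝓕 g z = ∫ x, g x * expTwoPi (-inner ℝ x z) := by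
    intro g z
    rw [Real.fourier_eq']
    refine integral_congr_ae (Eventually.of_forall fun x => ?_)
    dsimp only
    rw [smul_eq_mul, mul_comm, expTwoPi]
    congr 4
    ring
  have hint : ∀ z : ℂ, Integrable fun x => φ x * expTwoPi (-inner ℝ x z) := fun z =>
    Integrable.mul_expTwoPi φ.integrable (by fun_prop)
  refine ⟨⇑(𝓕 φ : SchwartzMap ℂ ℂ), (𝓕 φ : SchwartzMap ℂ ℂ).continuous,
    (𝓕 φ : SchwartzMap ℂ ℂ).integrable, fun z => ?_, fun z => ?_,
    fun f σ hf ξ hξ => ?_⟩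
  · rw [SchwartzMap.fourier_coe, hF]
    refine (norm_integral_le_integral_norm _).trans (le_of_eq ?_)
    simp only [norm_mul, norm_expTwoPi, mul_one, h1]
  · rw [SchwartzMap.fourier_coe, hF, ← h1', ← integral_sub (hint z) φ.integrable]
    refine (norm_integral_le_of_norm_le (g := fun x => ‖φ x‖ * (2 * Real.pi * ε * ‖z‖))
      (φ.integrable.norm.mul_const _) (Eventually.of_forall fun x => ?_)).trans (le_of_eq ?_)
    · rw [← mul_sub_one, norm_mul]
      rcases eq_or_ne (φ x) 0 with h0 | h0
      · simp [h0]
      refine mul_le_mul_of_nonneg_left ?_ (norm_nonneg _)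
      have hx : ‖x‖ ≤ ε := by
        have := hψs (subset_tsupport ψ (show ψ x ≠ 0 by rwa [← hφψ]))
        simpa using this
      refine (norm_expTwoPi_sub_one_le _).trans ?_
      rw [mul_assoc _ ε, abs_neg]
      have := Real.pi_pos
      gcongr
      exact (abs_real_inner_le_norm x z).trans (by gcongr)
    · rw [integral_mul_const, h1, one_mul]
  · set ψ' : ℂ → ℂ := ψ ∘ (Homeomorph.subRight ξ) with hψ'
    have hc' : HasCompactSupport ψ' := hc.comp_homeomorph _
    have hd' : ContDiff ℝ (⊤ : ℕ∞) ψ' := hd.comp (contDiff_id.sub contDiff_const)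
    have hs' : tsupport ψ' ⊆ Metric.closedBall ξ ε := by
      refine closure_minimal (fun x hx => ?_) Metric.isClosed_closedBall
      have := hψs (subset_tsupport ψ (show ψ (x - ξ) ≠ 0 from hx))
      rwa [mem_closedBall_zero_iff, ← dist_eq_norm] at this
    have hco : ⇑(hc'.toSchwartzMap hd') = ψ' := by ext x; simp
    have h := hf (hc'.toSchwartzMap hd') (by
      rw [hco]
      refine Set.disjoint_of_subset_left hs' (Metric.closedBall_disjoint_closedBall ?_)
      rw [dist_zero_right]
      linarith)
    rw [hco] at h
    rw [← h]
    refine integral_congr_ae (Eventually.of_forall fun z => ?_)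
    dsimp only
    rw [mul_assoc]
    congr 1
    rw [SchwartzMap.fourier_coe, hF, hF, ← integral_mul_const,
      ← integral_sub_right_eq_self _ ξ]
    refine integral_congr_ae (Eventually.of_forall fun x => ?_)
    dsimp only
    rw [hφψ, hψ', mul_assoc, ← expTwoPi_add]
    simp only [Function.comp_apply, Homeomorph.coe_subRight, inner_sub_left]
    rw [real_inner_comm ξ z]
    congr 2
    ring

lemma exists_traceBound_cfc_sub_of_fourier : ∃ C : ℝ, 0 < C ∧
    ∀ {H : Type*} [NormedAddCommGroup H] [InnerProductSpace ℂ H] [CompleteSpace H]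
      (F f : ℂ → ℂ) (R B c : ℝ) (N₁ N₂ : H →L[ℂ] H) [IsStarNormal N₁] [IsStarNormal N₂],
      Integrable F → Continuous f → (∀ ξ, F ξ ≠ 0 → ‖ξ‖ ≤ R) → 0 < R →
      (∀ z, f z = ∫ ξ, F ξ * expTwoPi (inner ℝ ξ z)) → 0 < B → (∀ z, ‖f z‖ ≤ B) →
      TraceBound (N₁ - N₂) c → TraceBound (cfc f N₁ - cfc f N₂) (C * R * B * c) := by
  obtain ⟨C, hC, key⟩ := exists_factorization_planeTrigIntegral
  refine ⟨2 * C * C, by positivity, ?_⟩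
  intro H _ _ _ F f R B c N₁ N₂ _ _ hF hf hFR hR hfF hB hfB hc
  obtain ⟨X₁, Y₁, X₂, Y₂, hX₁, hY₁, hX₂, hY₂, hfac⟩ := key volume F (fun ξ => ξ.re / R)
    (fun ξ => ξ.im / R) (fun z => f ((R⁻¹ : ℝ) * z)) B hF (by fun_prop) (by fun_prop)
    (fun ξ hξ => by
      rw [abs_div, abs_of_pos hR, div_le_one hR]
      exact (Complex.abs_re_le_norm ξ).trans (hFR ξ hξ))
    (fun ξ hξ => by
      rw [abs_div, abs_of_pos hR, div_le_one hR]
      exact (Complex.abs_im_le_norm ξ).trans (hFR ξ hξ))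
    (fun z => by
      rw [hfF]
      refine integral_congr_ae (Eventually.of_forall fun ξ => ?_)
      dsimp only
      congr 2
      simp [Complex.inner]
      ring) hB (fun z => hfB _)
  have hscale : ∀ X : ℂ → Lp ℂ 2 (volume : Measure ℝ), (∀ z, ‖X z‖ ≤ C) →
      ∀ z : ℂ, ‖(R : ℂ) • X ((R : ℂ) * z)‖ ≤ R * C := fun X hX z => by
    rw [norm_smul, Complex.norm_real, Real.norm_of_nonneg hR.le]
    gcongr
    exact hX _
  refine (TraceBound.cfc_sub_of_factorization hf (mul_nonneg hR.le hC.le) (mul_nonneg hC.le hB.le)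
    (X₁ := fun z => (R : ℂ) • X₁ ((R : ℂ) * z)) (Y₁ := fun z => Y₁ ((R : ℂ) * z))
    (X₂ := fun z => (R : ℂ) • X₂ ((R : ℂ) * z)) (Y₂ := fun z => Y₂ ((R : ℂ) * z))
    (hscale X₁ hX₁) (fun z => hY₁ _) (hscale X₂ hX₂) (fun z => hY₂ _) (fun z w => ?_) hc).mono
    (le_of_eq (by ring))
  have h := hfac (R * z) (R * w)
  have hRc : (R : ℂ) ≠ 0 := by exact_mod_cast hR.ne'
  simp only [Complex.ofReal_inv, inv_mul_cancel_left₀ hRc, Complex.re_ofReal_mul,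
    Complex.im_ofReal_mul] at h
  rw [h]
  simp only [inner_smul_left, Complex.conj_ofReal]
  push_cast
  ring

lemma exists_traceBound_cfc_sub_of_fourierSupportedIn : ∃ C : ℝ, 0 < C ∧
    ∀ {H : Type*} [NormedAddCommGroup H] [InnerProductSpace ℂ H] [CompleteSpace H]
      (f : BoundedContinuousFunction ℂ ℂ) (σ c : ℝ) (N₁ N₂ : H →L[ℂ] H) [IsStarNormal N₁]
      [IsStarNormal N₂], 0 < σ → FourierSupportedIn f σ →
      TraceBound (N₁ - N₂) c → TraceBound (cfc f N₁ - cfc f N₂) (C * σ * ‖f‖ * c) := by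
  obtain ⟨C, hC, key⟩ := exists_traceBound_cfc_sub_of_fourier
  refine ⟨2 * C, by positivity, ?_⟩
  intro H _ _ _ f σ c N₁ N₂ _ _ hσ hf hc
  rcases (norm_nonneg f).eq_or_lt with h0 | h0
  · have : f = 0 := norm_eq_zero.1 h0.symm
    subst this
    intro ι _ e g C₁ C₂ _ _ _ _
    simp
  have hε : ∀ n : ℕ, 0 < σ / (n + 1) := fun n => by positivity
  choose κ hκc hκi hκ1 hκ hκF using fun n => exists_integrable_cutoff (hε n)
  have hmul : ∀ n, Continuous fun z => f z * κ n z := fun n => f.continuous.mul (hκc n)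
  refine TraceBound.of_tendsto (A := fun n => cfc (fun z => f z * κ n z) N₁ -
    cfc (fun z => f z * κ n z) N₂) (fun n => ?_) ?_
  · have hint : Integrable fun z => f z * κ n z :=
      (hκi n).bdd_mul (c := ‖f‖) f.continuous.aestronglyMeasurable
        (Eventually.of_forall f.norm_coe_le_norm)
    set F : ℂ → ℂ := 𝓕 (fun z => f z * κ n z) with hF
    have hFe : ∀ ξ, F ξ = ∫ z, f z * κ n z * expTwoPi (-inner ℝ z ξ) := by
      intro ξ
      rw [hF, Real.fourier_eq']
      refine integral_congr_ae (Eventually.of_forall fun x => ?_)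
      dsimp only
      rw [smul_eq_mul, mul_comm, expTwoPi]
      congr 4
      ring
    have hFR : ∀ ξ, F ξ ≠ 0 → ‖ξ‖ ≤ 2 * σ := by
      intro ξ hξ
      by_contra! hlt
      refine hξ ((hFe ξ).trans (hκF n f σ hf ξ ?_))
      have : σ / (n + 1) ≤ σ := div_le_self hσ.le (by linarith [Nat.cast_nonneg (α := ℝ) n])
      linarith
    have hFc : Continuous F := by
      rw [funext hFe]
      refine continuous_of_dominated (bound := fun z => ‖f z * κ n z‖) (fun ξ => ?_)
        (fun ξ => Eventually.of_forall fun z => by rw [norm_mul, norm_expTwoPi, mul_one])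
        hint.norm (Eventually.of_forall fun z => ?_)
      · exact (Integrable.mul_expTwoPi hint (by fun_prop)).aestronglyMeasurable
      · exact continuous_const.mul (continuous_expTwoPi.comp (by fun_prop))
    have hFi : Integrable F := hFc.integrable_of_hasCompactSupport
      (HasCompactSupport.of_support_subset_isCompact (isCompact_closedBall (0 : ℂ) (2 * σ))
        fun ξ hξ => by simpa using hFR ξ hξ)
    refine (key F (fun z => f z * κ n z) (2 * σ) ‖f‖ c N₁ N₂ hFi (hmul n) hFR (by positivity)
      (fun z => ?_) h0 (fun z => ?_) hc).mono (le_of_eq (by ring))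
    · have h := congrFun ((hmul n).fourierInv_fourier_eq hint hFi) z
      rw [← h, Real.fourierInv_eq']
      refine integral_congr_ae (Eventually.of_forall fun x => ?_)
      dsimp only
      rw [smul_eq_mul, mul_comm, expTwoPi]
    · rw [norm_mul]
      calc _ ≤ ‖f‖ * 1 := mul_le_mul (f.norm_coe_le_norm z) (hκ1 n z) (norm_nonneg _) h0.le
        _ = _ := mul_one _
  · have hconv : ∀ N : H →L[ℂ] H,
        Tendsto (fun n => cfc (fun z => f z * κ n z) N) atTop (nhds (cfc f N)) := by
      intro N
      obtain ⟨r, hr⟩ := (spectrum.isCompact (𝕜 := ℂ) N).isBounded.exists_norm_le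
      refine tendsto_iff_norm_sub_tendsto_zero.2 (squeeze_zero (fun _ => norm_nonneg _)
        (g := fun n : ℕ => ‖f‖ * (2 * Real.pi * (σ / (n + 1)) * |r|)) (fun n => ?_) ?_)
      · rw [← cfc_sub _ _ N (hmul n).continuousOn f.continuous.continuousOn]
        have := Real.pi_pos
        refine norm_cfc_le (by have := hε n; positivity) fun z hz => ?_
        rw [← mul_sub_one, norm_mul]
        refine mul_le_mul (f.norm_coe_le_norm z) ((hκ n z).trans ?_) (norm_nonneg _) h0.le
        have h3 := hε n
        gcongr
        exact (hr z hz).trans (le_abs_self r)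
      · have ht := tendsto_one_div_add_atTop_nhds_zero_nat (𝕜 := ℝ)
        have := (((ht.const_mul σ).const_mul (2 * Real.pi)).mul_const |r|).const_mul ‖f‖
        simpa [div_eq_mul_inv] using this
    exact (hconv N₁).sub (hconv N₂)

section LorentzSums

lemma sub_one_mul_rpow_neg_le {q y : ℝ} (hq : 1 < q) (hy : 0 < y) :
    (q - 1) * (y + 1) ^ (-q) ≤ y ^ (1 - q) - (y + 1) ^ (1 - q) := by
  have hy1 : 0 < y + 1 := by linarith
  have hr : 0 < y / (y + 1) := div_pos hy hy1
  have h1 : 1 + (q - 1) / (y + 1) ≤ (y / (y + 1)) ^ (1 - q) := by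
    rw [Real.rpow_def_of_pos hr]
    have h2 := Real.add_one_le_exp (Real.log (y / (y + 1)) * (1 - q))
    have h3 := Real.log_le_sub_one_of_pos hr
    have h4 : y / (y + 1) - 1 = -(1 / (y + 1)) := by field_simp; ring
    rw [h4] at h3
    have h5 : (q - 1) / (y + 1) = (q - 1) * (1 / (y + 1)) := by ring
    nlinarith
  rw [Real.div_rpow hy.le hy1.le, le_div_iff₀ (Real.rpow_pos_of_pos hy1 _)] at h1
  have h6 : (y + 1) ^ (1 - q) = (y + 1) * (y + 1) ^ (-q) := by
    rw [sub_eq_add_neg, Real.rpow_add hy1, Real.rpow_one]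
  have h7 : (1 + (q - 1) / (y + 1)) * (y + 1) ^ (1 - q) =
      (y + 1) ^ (1 - q) + (q - 1) * (y + 1) ^ (-q) := by
    rw [add_mul, one_mul, h6]
    field_simp
  linarith

lemma sum_add_rpow_neg_le {q y : ℝ} (hq : 1 < q) (hy : 0 < y) (K : ℕ) :
    ∑ k ∈ Finset.range K, (y + k + 1) ^ (-q) ≤ y ^ (1 - q) / (q - 1) := by
  have hq0 : 0 < q - 1 := by linarith
  rw [le_div_iff₀ hq0, mul_comm, Finset.mul_sum]
  have h : ∀ k ∈ Finset.range K, (q - 1) * (y + k + 1) ^ (-q) ≤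
      (y + k) ^ (1 - q) - (y + (k + 1 : ℕ)) ^ (1 - q) := fun k _ => by
    have := sub_one_mul_rpow_neg_le hq (show 0 < y + k by positivity)
    push_cast
    rwa [← add_assoc]
  refine (Finset.sum_le_sum h).trans ?_
  rw [Finset.sum_range_sub' (fun k : ℕ => (y + k) ^ (1 - q))]
  have : 0 ≤ (y + K) ^ (1 - q) := by positivity
  simp only [Nat.cast_zero, add_zero]
  linarith

lemma sum_min_div_rpow_le {q a b : ℝ} (hq : 1 < q) (ha : 0 ≤ a) (hb : 0 ≤ b) (K : ℕ) :
    ∑ k ∈ Finset.range K, (min (a / (k + 1)) b) ^ q ≤ 2 ^ q / (q - 1) * (a * b ^ (q - 1)) := by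
  have hq0 : 0 < q - 1 := by linarith
  have hqp : q ≠ 0 := by linarith
  rcases ha.eq_or_lt with rfl | ha
  · simp [hb, Real.zero_rpow hqp]
  rcases hb.eq_or_lt with rfl | hb
  · have h : ∀ k : ℕ, min (a / (k + 1)) 0 = 0 := fun k => min_eq_right (by positivity)
    simp [h, Real.zero_rpow hqp, Real.zero_rpow hq0.ne']
  have hy : 0 < a / b := div_pos ha hb
  calc _ ≤ ∑ k ∈ Finset.range K, (2 * a) ^ q * (a / b + k + 1) ^ (-q) := by
        refine Finset.sum_le_sum fun k _ => ?_
        have hpos : 0 < a / b + k + 1 := by positivity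
        rw [Real.rpow_neg hpos.le, ← div_eq_mul_inv, ← Real.div_rpow (by positivity) hpos.le]
        refine Real.rpow_le_rpow (by positivity) ?_ (by linarith)
        rw [le_div_iff₀ hpos]
        have h1 : min (a / (k + 1)) b * (a / b) ≤ a := by
          calc _ ≤ b * (a / b) := by gcongr; exact min_le_right _ _
            _ = a := by field_simp
        have h2 : min (a / (k + 1)) b * (k + 1) ≤ a := by
          calc _ ≤ a / (k + 1) * (k + 1) := by gcongr; exact min_le_left _ _
            _ = a := by field_simp
        linarith
    _ ≤ (2 * a) ^ q * ((a / b) ^ (1 - q) / (q - 1)) := by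
        rw [← Finset.mul_sum]
        gcongr
        exact sum_add_rpow_neg_le hq hy K
    _ = _ := by
        have h1 : (a / b) ^ (1 - q) = b ^ (q - 1) / a ^ (q - 1) := by
          rw [← neg_sub, Real.rpow_neg hy.le, Real.div_rpow ha.le hb.le, inv_div]
        have h2 : a ^ q = a * a ^ (q - 1) := by
          rw [Real.rpow_sub_one ha.ne']
          field_simp
        rw [h1, Real.mul_rpow zero_le_two ha.le, h2]
        have : a ^ (q - 1) ≠ 0 := (Real.rpow_pos_of_pos ha _).ne'
        field_simp

lemma sum_sum_rpow_le {ι κ : Type*} {q : ℝ} (hq : 1 ≤ q) (s : Finset ι) (t : Finset κ)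
    {g : κ → ι → ℝ} (hg : ∀ n i, 0 ≤ g n i) :
    (∑ i ∈ s, (∑ n ∈ t, g n i) ^ q) ^ (1 / q) ≤ ∑ n ∈ t, (∑ i ∈ s, g n i ^ q) ^ (1 / q) := by
  classical
  have hq0 : q ≠ 0 := by linarith
  induction t using Finset.induction_on with
  | empty => simp [Real.zero_rpow hq0, Real.zero_rpow (inv_ne_zero hq0)]
  | insert m t hm ih =>
    simp only [Finset.sum_insert hm]
    exact (Real.Lp_add_le_of_nonneg s hq (fun i _ => hg m i)
      fun i _ => Finset.sum_nonneg fun n _ => hg n i).trans (by gcongr)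

end LorentzSums

section SchattenSums

variable {H : Type*} [NormedAddCommGroup H] [InnerProductSpace ℂ H]

lemma sum_norm_inner_le_card_mul_norm {n : ℕ} {e f : Fin n → H} (he : Orthonormal ℂ e)
    (hf : Orthonormal ℂ f) (A : H →L[ℂ] H) : ∑ i, ‖inner ℂ (f i) (A (e i))‖ ≤ n * ‖A‖ := by
  have h : ∀ i ∈ Finset.univ, ‖inner ℂ (f i) (A (e i))‖ ≤ ‖A‖ := fun i _ => by
    refine (norm_inner_le_norm _ _).trans ?_
    rw [hf.1 i, one_mul]
    simpa [he.1 i] using A.le_opNorm (e i)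
  simpa using Finset.sum_le_card_nsmul _ _ _ h

lemma sNum_le_sum_min_add {ι : Type*} {A : ι → H →L[ℂ] H} {a b : ι → ℝ}
    (hA : ∀ n, TraceBound (A n) (a n)) (ha : ∀ n, 0 ≤ a n) (hb : ∀ n, ‖A n‖ ≤ b n)
    (T : H →L[ℂ] H) (s : Finset ι) (k : ℕ) :
    sNum T (2 * k) ≤ ∑ n ∈ s, min (a n / (k + 1)) (b n) + ‖T - ∑ n ∈ s, A n‖ := by
  have hb0 : ∀ n, 0 ≤ b n := fun n => (norm_nonneg _).trans (hb n)
  by_contra! hlt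
  obtain ⟨c, hc, hcs⟩ := exists_between hlt
  have hpos : 0 ≤ ∑ n ∈ s, min (a n / (k + 1)) (b n) + ‖T - ∑ n ∈ s, A n‖ :=
    add_nonneg (Finset.sum_nonneg fun n _ => le_min (div_nonneg (ha n) (by positivity)) (hb0 n))
      (norm_nonneg _)
  obtain ⟨e, f, he, hf, hef⟩ := exists_orthonormal_inner_ge (hpos.trans hc.le) hcs
  have h1 : (k + 1) * c ≤ ∑ i, ‖inner ℂ (f i) (T (e i))‖ := by
    simpa using Finset.card_nsmul_le_sum Finset.univ _ c fun i _ => hef i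
  have h2 : ∑ i, ‖inner ℂ (f i) (T (e i))‖ ≤ ∑ i, ∑ n ∈ s, ‖inner ℂ (f i) (A n (e i))‖ +
      ∑ i, ‖inner ℂ (f i) ((T - ∑ n ∈ s, A n) (e i))‖ := by
    rw [← Finset.sum_add_distrib]
    refine Finset.sum_le_sum fun i _ => ?_
    have hT : inner ℂ (f i) (T (e i)) = ∑ n ∈ s, inner ℂ (f i) (A n (e i)) +
        inner ℂ (f i) ((T - ∑ n ∈ s, A n) (e i)) := by
      rw [← inner_sum, ← inner_add_right]
      simp [sum_apply]
    rw [hT]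
    exact (norm_add_le _ _).trans (add_le_add_left (norm_sum_le _ _) _)
  have h3 := sum_norm_inner_le_card_mul_norm he hf (T - ∑ n ∈ s, A n)
  have h4 : ∑ i, ∑ n ∈ s, ‖inner ℂ (f i) (A n (e i))‖ ≤
      (k + 1) * ∑ n ∈ s, min (a n / (k + 1)) (b n) := by
    rw [Finset.sum_comm, Finset.mul_sum]
    refine Finset.sum_le_sum fun n _ => ?_
    have hk : (0 : ℝ) < k + 1 := by positivity
    rw [mul_min_of_nonneg _ _ hk.le, mul_div_cancel₀ _ hk.ne']
    refine le_min ((hA n).sum_inner_le he hf) ?_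
    have h5 := sum_norm_inner_le_card_mul_norm he hf (A n)
    push_cast at h5
    exact h5.trans (mul_le_mul_of_nonneg_left (hb n) hk.le)
  rw [Nat.cast_succ] at h3
  have hk : (0 : ℝ) < k + 1 := by positivity
  nlinarith

lemma sum_sNum_rpow_le {q : ℝ} (hq : 0 ≤ q) (T : H →L[ℂ] H) (K : ℕ) :
    ∑ j ∈ Finset.range (2 * K), sNum T j ^ q ≤
      2 * ∑ k ∈ Finset.range K, sNum T (2 * k) ^ q := by
  induction K with
  | zero => simp
  | succ K ih =>
    rw [show 2 * (K + 1) = 2 * K + 1 + 1 by ring, Finset.sum_range_succ, Finset.sum_range_succ,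
      Finset.sum_range_succ]
    have h := Real.rpow_le_rpow (sNum_nonneg T (2 * K + 1))
      (sNum_antitone T (Nat.le_succ (2 * K))) hq
    linarith

lemma memSchatten_and_schattenNorm_le_of_sum_le {q B : ℝ} (hq : 1 ≤ q) (hB : 0 ≤ B)
    {T : H →L[ℂ] H}
    (h : ∀ K : ℕ, (∑ k ∈ Finset.range K, sNum T (2 * k) ^ q) ^ (1 / q) ≤ B) :
    MemSchatten q T ∧ schattenNorm q T ≤ 2 * B := by
  have hq0 : 0 < q := by linarith
  have h0 : ∀ j, 0 ≤ sNum T j ^ q := fun j => Real.rpow_nonneg (sNum_nonneg T j) q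
  have hle : ∀ n, ∑ j ∈ Finset.range n, sNum T j ^ q ≤ 2 * B ^ q := fun n => by
    refine (Finset.sum_le_sum_of_subset_of_nonneg
      (Finset.range_mono (show n ≤ 2 * n by omega)) fun j _ _ => h0 j).trans ?_
    refine (sum_sNum_rpow_le hq0.le T n).trans ?_
    gcongr
    have h1 := Real.rpow_le_rpow (Real.rpow_nonneg (Finset.sum_nonneg fun k _ => h0 (2 * k)) _)
      (h n) hq0.le
    rwa [← Real.rpow_mul (Finset.sum_nonneg fun k _ => h0 (2 * k)), one_div,
      inv_mul_cancel₀ hq0.ne', Real.rpow_one] at h1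
  refine ⟨summable_of_sum_range_le h0 hle, ?_⟩
  have h2 : ∑' j, sNum T j ^ q ≤ (2 * B) ^ q := by
    refine (Real.tsum_le_of_sum_range_le h0 hle).trans ?_
    rw [Real.mul_rpow zero_le_two hB]
    gcongr
    exact Real.self_le_rpow_of_one_le one_le_two hq
  refine (Real.rpow_le_rpow (tsum_nonneg h0) h2 (by positivity)).trans (le_of_eq ?_)
  rw [← Real.rpow_mul (by positivity), mul_one_div_cancel hq0.ne', Real.rpow_one]

lemma memSchatten_and_schattenNorm_le_of_tendsto {q W : ℝ} (hq : 1 < q) {A : ℤ → H →L[ℂ] H}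
    {T : H →L[ℂ] H} {a b : ℤ → ℝ} (hA : ∀ n, TraceBound (A n) (a n)) (ha : ∀ n, 0 ≤ a n)
    (hb : ∀ n, ‖A n‖ ≤ b n)
    (hT : Tendsto (fun N : ℕ => ∑ n ∈ Finset.Icc (-(N : ℤ)) N, A n) atTop (nhds T))
    (hW : ∀ N : ℕ, ∑ n ∈ Finset.Icc (-(N : ℤ)) N, (a n * b n ^ (q - 1)) ^ (1 / q) ≤ W) :
    MemSchatten q T ∧ schattenNorm q T ≤ 2 * ((2 ^ q / (q - 1)) ^ (1 / q) * W) := by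
  have hq0 : 0 < q := by linarith
  have hq1 : 0 < q - 1 := by linarith
  have hb0 : ∀ n, 0 ≤ b n := fun n => (norm_nonneg _).trans (hb n)
  have hW0 : 0 ≤ W := (Finset.sum_nonneg fun n _ => Real.rpow_nonneg
    (mul_nonneg (ha n) (Real.rpow_nonneg (hb0 n) _)) _).trans (hW 0)
  set D : ℝ := 2 ^ q / (q - 1) with hD
  have hD0 : 0 ≤ D := by positivity
  refine memSchatten_and_schattenNorm_le_of_sum_le hq.le (by positivity) fun K => ?_
  have hlim : Tendsto (fun N : ℕ => D ^ (1 / q) * W + (K : ℝ) ^ (1 / q) *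
      ‖T - ∑ n ∈ Finset.Icc (-(N : ℤ)) N, A n‖) atTop (nhds (D ^ (1 / q) * W)) := by
    have := ((tendsto_const_nhds (x := T)).sub hT).norm
    rw [sub_self, norm_zero] at this
    simpa using (this.const_mul ((K : ℝ) ^ (1 / q))).const_add (D ^ (1 / q) * W)
  refine ge_of_tendsto' hlim fun N => ?_
  set s := Finset.Icc (-(N : ℤ)) N
  set ε := ‖T - ∑ n ∈ s, A n‖ with hε
  have hmin : ∀ n (k : ℕ), 0 ≤ min (a n / (k + 1)) (b n) := fun n k =>
    le_min (div_nonneg (ha n) (by positivity)) (hb0 n)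
  calc _ ≤ (∑ k ∈ Finset.range K, (∑ n ∈ s, min (a n / (k + 1)) (b n) + ε) ^ q) ^ (1 / q) := by
        refine Real.rpow_le_rpow (Finset.sum_nonneg fun k _ => Real.rpow_nonneg
          (sNum_nonneg T _) q) (Finset.sum_le_sum fun k _ => ?_) (by positivity)
        exact Real.rpow_le_rpow (sNum_nonneg T _) (sNum_le_sum_min_add hA ha hb T s k) hq0.le
    _ ≤ (∑ k ∈ Finset.range K, (∑ n ∈ s, min (a n / (k + 1)) (b n)) ^ q) ^ (1 / q) +
        (∑ _k ∈ Finset.range K, ε ^ q) ^ (1 / q) :=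
        Real.Lp_add_le_of_nonneg _ hq.le (fun k _ => Finset.sum_nonneg fun n _ => hmin n k)
          fun _ _ => norm_nonneg _
    _ ≤ D ^ (1 / q) * W + (K : ℝ) ^ (1 / q) * ε := by
        refine add_le_add ((sum_sum_rpow_le hq.le _ _ (g := fun n (k : ℕ) =>
          min (a n / (k + 1)) (b n)) hmin).trans ?_) (le_of_eq ?_)
        · refine le_trans ?_ (mul_le_mul_of_nonneg_left (hW N) (by positivity))
          rw [Finset.mul_sum]
          refine Finset.sum_le_sum fun n _ => ?_
          rw [← Real.mul_rpow hD0 (mul_nonneg (ha n) (Real.rpow_nonneg (hb0 n) _))]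
          exact Real.rpow_le_rpow (Finset.sum_nonneg fun k _ => Real.rpow_nonneg (hmin n k) q)
            (sum_min_div_rpow_le hq (ha n) (hb0 n) K) (by positivity)
        · rw [Finset.sum_const, Finset.card_range, nsmul_eq_mul,
            Real.mul_rpow (by positivity) (by positivity), ← Real.rpow_mul (norm_nonneg _),
            mul_one_div_cancel hq0.ne', Real.rpow_one]

end SchattenSums

lemma tendsto_sum_cfc_sub_cfc {H : Type*} [NormedAddCommGroup H] [InnerProductSpace ℂ H]
    [CompleteSpace H] {F : ℤ → BoundedContinuousFunction ℂ ℂ} {f : ℂ → ℂ}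
    (hF : ∀ K : Set ℂ, IsCompact K → TendstoUniformlyOn
      (fun (N : ℕ) z => ∑ n ∈ Finset.Icc (-(N : ℤ)) (N : ℤ), F n z) f atTop K)
    (N₁ N₂ : H →L[ℂ] H) [IsStarNormal N₁] [IsStarNormal N₂] :
    Tendsto (fun N : ℕ => ∑ n ∈ Finset.Icc (-(N : ℤ)) N, (cfc (F n) N₁ - cfc (F n) N₂)) atTop
      (nhds (cfc f N₁ - cfc f N₂)) := by
  have key : ∀ (T : H →L[ℂ] H) [IsStarNormal T], Tendsto
      (fun N : ℕ => ∑ n ∈ Finset.Icc (-(N : ℤ)) N, cfc (F n) T) atTop (nhds (cfc f T)) := by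
    intro T _
    have h := tendsto_cfc_fun (a := T) (hF _ (spectrum.isCompact (𝕜 := ℂ) T))
      (Eventually.of_forall fun N => continuousOn_finsetSum _ fun n _ =>
        (F n).continuous.continuousOn)
    refine h.congr fun N => ?_
    rw [← cfc_sum (fun n z => F n z) T _ fun n _ => (F n).continuous.continuousOn]
    congr 1
    ext z
    simp
  simpa only [Finset.sum_sub_distrib] using (key N₁).sub (key N₂)

lemma norm_cfc_sub_cfc_le {H : Type*} [NormedAddCommGroup H] [InnerProductSpace ℂ H]
    [CompleteSpace H] (f : BoundedContinuousFunction ℂ ℂ) (N₁ N₂ : H →L[ℂ] H) :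
    ‖cfc f N₁ - cfc f N₂‖ ≤ 2 * ‖f‖ := by
  have h : ∀ N : H →L[ℂ] H, ‖cfc f N‖ ≤ ‖f‖ := fun N =>
    norm_cfc_le (norm_nonneg _) fun z _ => f.norm_coe_le_norm z
  have h1 := norm_sub_le (cfc f N₁) (cfc f N₂)
  linarith [h N₁, h N₂]

/-- Let `0 < α < 1`. There is `c > 0` (depending only on `α`) such that if
`f ∈ B^α_{∞1}(ℝ²)` with Besov norm at most `M`, and `N₁, N₂` are bounded normal
operators with `N₁ - N₂ ∈ S₁`, then `f(N₁) - f(N₂) ∈ S_{1/α}` and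
`‖f(N₁) - f(N₂)‖_{S_{1/α}} ≤ c M ‖N₁ - N₂‖_{S₁}^α`. -/
theorem besov_alpha_trace_class :
    ∀ (α : ℝ), 0 < α → α < 1 →
    ∃ c : ℝ, 0 < c ∧
      ∀ (f : ℂ → ℂ) (M : ℝ), HasLPDecompBesov f α M →
      ∀ (H : Type*) [NormedAddCommGroup H] [InnerProductSpace ℂ H] [CompleteSpace H]
        (N₁ N₂ : H →L[ℂ] H), IsStarNormal N₁ → IsStarNormal N₂ →
        MemSchatten 1 (N₁ - N₂) →
        MemSchatten (1 / α) (cfc f N₁ - cfc f N₂) ∧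
          schattenNorm (1 / α) (cfc f N₁ - cfc f N₂) ≤
            c * M * schattenNorm 1 (N₁ - N₂) ^ α := by
  intro α hα hα1
  obtain ⟨C, hC, key⟩ := exists_traceBound_cfc_sub_of_fourierSupportedIn
  set q : ℝ := 1 / α with hq
  have hq1 : 1 < q := by rwa [hq, lt_div_iff₀ hα, one_mul]
  have hqα : 1 / q = α := by rw [hq, one_div_one_div]
  have hqs : 0 < q - 1 := by linarith
  refine ⟨2 * ((2 ^ q / (q - 1)) ^ (1 / q) * (2 * (28 * C) ^ α)), by positivity, ?_⟩
  rintro f M ⟨F, hFs, hFc, hsum, hM⟩ H _ _ _ N₁ N₂ hN₁ hN₂ hN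
  set S := ∑' j, sNum (N₁ - N₂) j with hS
  have hS0 : 0 ≤ S := tsum_nonneg fun j => sNum_nonneg _ j
  have hS1 : schattenNorm 1 (N₁ - N₂) = S := by simp [schattenNorm, hS]
  have hterm : ∀ n : ℤ, (C * 2 ^ (n + 1) * ‖F n‖ * (14 * S) * (2 * ‖F n‖) ^ (q - 1)) ^ (1 / q) ≤
      2 * (28 * C) ^ α * S ^ α * ((2 : ℝ) ^ ((n : ℝ) * α) * ‖F n‖) := by
    intro n
    have hx : 0 ≤ ‖F n‖ := norm_nonneg _
    generalize ‖F n‖ = x at hx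
    have h2 : ((2 * x) ^ (q - 1)) ^ α = (2 * x) ^ (1 - α) := by
      rw [← Real.rpow_mul (by positivity), sub_mul, hq, one_div_mul_cancel hα.ne', one_mul]
    have h3 : ((2 : ℝ) ^ (n + 1)) ^ α = 2 ^ α * 2 ^ ((n : ℝ) * α) := by
      rw [zpow_add_one₀ two_ne_zero, mul_comm, Real.mul_rpow (by positivity) (by positivity),
        ← Real.rpow_intCast, ← Real.rpow_mul (by positivity)]
    have h4 : x ^ α * x ^ (1 - α) = x := by
      rw [← Real.rpow_add' hx (by norm_num), add_sub_cancel, Real.rpow_one]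
    have h5 : (28 : ℝ) ^ α = 14 ^ α * 2 ^ α := by
      rw [← Real.mul_rpow (by positivity) (by positivity)]
      norm_num
    have h6 : (2 : ℝ) ^ (1 - α) ≤ 2 := by
      calc (2 : ℝ) ^ (1 - α) ≤ 2 ^ (1 : ℝ) :=
            Real.rpow_le_rpow_of_exponent_le one_le_two (by linarith)
        _ = 2 := Real.rpow_one 2
    rw [hqα, Real.mul_rpow (by positivity) (by positivity), h2,
      Real.mul_rpow (by positivity) (by positivity), Real.mul_rpow (by positivity) (by positivity),
      Real.mul_rpow (by positivity) (by positivity), Real.mul_rpow (by positivity) hS0, h3,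
      Real.mul_rpow zero_le_two hx, Real.mul_rpow (by positivity) hC.le, h5]
    calc _ = 2 ^ (1 - α) * (14 ^ α * 2 ^ α * C ^ α * S ^ α * 2 ^ ((n : ℝ) * α) *
          (x ^ α * x ^ (1 - α))) := by ring
      _ ≤ 2 * (14 ^ α * 2 ^ α * C ^ α * S ^ α * 2 ^ ((n : ℝ) * α) * (x ^ α * x ^ (1 - α))) := by
          gcongr
      _ = _ := by rw [h4]; ring
  have h := memSchatten_and_schattenNorm_le_of_tendsto hq1
    (W := 2 * (28 * C) ^ α * S ^ α * M)
    (fun n => key (F n) _ _ N₁ N₂ (by positivity) (hFs n) hN.traceBound)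
    (fun n => by positivity) (fun n => norm_cfc_sub_cfc_le (F n) N₁ N₂)
    (tendsto_sum_cfc_sub_cfc hFc N₁ N₂) (fun N => ?_)
  · refine ⟨h.1, h.2.trans (le_of_eq ?_)⟩
    rw [hS1]
    ring
  · refine (Finset.sum_le_sum fun n _ => hterm n).trans ?_
    rw [← Finset.mul_sum]
    gcongr
    exact (hsum.sum_le_tsum _ fun n _ => by positivity).trans hM
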